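/- arXiv:1303.1088 — 3 statements merged into one kernel-verified Lean document; each statement's English description precedes it below -/
import Mathlib

section
/- Existence and uniqueness of the equivariance homomorphism for a lifted map: Let Γ and Δ be subgroups of SL(2,ℝ). Assume Δ acts freely on ℍ (every δ ∈ Δ with δ ≠ 1 satisfies δ • z ≠ z for all z ∈ ℍ) and properly discontinuously on ℍ (for every compact K ⊆ ℍ only finitely many δ ∈ Δ satisfy (δ • K) ∩ K ≠ ∅). Let p : ℍ → ℍ be a continuous map such that for every γ ∈ Γ and every z ∈ ℍ there exists δ ∈ Δ with p(γ • z) = δ • p(z). Then there exists a unique group homomorphism ρ : Γ → Δ such that p(γ • z) = ρ(γ) • p(z) for all γ ∈ Γ and all z ∈ ℍ. -/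
open UpperHalfPlane Matrix

local notation "SL2R" => Matrix.SpecialLinearGroup (Fin 2) ℝ

/-- **Existence and uniqueness of the equivariance homomorphism for a lifted map.**
If `Δ ≤ SL(2,ℝ)` acts freely and properly discontinuously on `ℍ`, and `p : ℍ → ℍ` is a
continuous map such that each `p (γ • ·)` agrees pointwise with `δ • p ·` for some `δ ∈ Δ`
(depending a priori on the point), then there is a unique group homomorphism `ρ : Γ → Δ`
with `p (γ • z) = ρ(γ) • p z` for all `γ ∈ Γ`, `z ∈ ℍ`. -/
theorem existsUnique_equivariance_homomorphism
    (Γ Δ : Subgroup SL2R)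
    (hfree : ∀ δ : SL2R, δ ∈ Δ → δ ≠ 1 → ∀ z : ℍ, δ • z ≠ z)
    (hproper : ∀ K : Set ℍ, IsCompact K →
      {δ : Δ | (((fun z : ℍ => (δ : SL2R) • z) '' K) ∩ K).Nonempty}.Finite)
    (p : ℍ → ℍ) (hp : Continuous p)
    (hsemi : ∀ (γ : Γ) (z : ℍ), ∃ δ ∈ Δ, p ((γ : SL2R) • z) = δ • p z) :
    ∃! ρ : Γ →* Δ, ∀ (γ : Γ) (z : ℍ), p ((γ : SL2R) • z) = ((ρ γ : Δ) : SL2R) • p z := by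
  have huniq : ∀ (a b : Δ) (w : ℍ), (a : SL2R) • w = (b : SL2R) • w → a = b := by
    intro a b w h
    by_contra hne
    refine hfree ((b : SL2R)⁻¹ * a) (Δ.mul_mem (Δ.inv_mem b.2) a.2) ?_ w ?_
    · intro h1
      exact hne (Subtype.ext (inv_mul_eq_one.mp h1).symm)
    · rw [mul_smul, h, inv_smul_smul]
  have hex : ∀ γ : Γ, ∃ δ : Δ, ∀ z : ℍ, p ((γ : SL2R) • z) = (δ : SL2R) • p z := by
    intro γ
    have h0 : ∀ z : ℍ, ∃ δ : Δ, p ((γ : SL2R) • z) = (δ : SL2R) • p z := fun z => by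
      obtain ⟨δ, hδ, h⟩ := hsemi γ z
      exact ⟨⟨δ, hδ⟩, h⟩
    choose d hd using h0
    have hpg : Continuous fun z : ℍ => p ((γ : SL2R) • z) :=
      hp.comp (continuous_const_smul (γ : SL2R))
    have hloc : IsLocallyConstant d := by
      rw [IsLocallyConstant.iff_eventually_eq]
      intro z₀
      obtain ⟨K₁, hK₁, hn₁⟩ := exists_compact_mem_nhds (p z₀)
      obtain ⟨K₂, hK₂, hn₂⟩ := exists_compact_mem_nhds (p ((γ : SL2R) • z₀))
      have hF := hproper (K₁ ∪ K₂) (hK₁.union hK₂)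
      have hsep : ∀ δ ∈ {δ : Δ | (((fun z : ℍ => (δ : SL2R) • z) '' (K₁ ∪ K₂)) ∩
          (K₁ ∪ K₂)).Nonempty}, ∀ᶠ z in nhds z₀, δ ≠ d z₀ →
            p ((γ : SL2R) • z) ≠ (δ : SL2R) • p z := by
        intro δ _
        by_cases hδ : δ = d z₀
        · exact Filter.Eventually.of_forall fun z h => absurd hδ h
        · have hne : p ((γ : SL2R) • z₀) ≠ (δ : SL2R) • p z₀ := fun h =>
            hδ (huniq _ _ _ (h.symm.trans (hd z₀)))
          have hc : Continuous fun z : ℍ => (δ : SL2R) • p z := hp.const_smul (δ : SL2R)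
          filter_upwards [(isOpen_ne_fun hpg hc).mem_nhds hne] with z hz _ using hz
      have hall := (Filter.eventually_all_finite hF).2 hsep
      filter_upwards [hall, hp.continuousAt.preimage_mem_nhds hn₁,
        hpg.continuousAt.preimage_mem_nhds hn₂] with z hz h1 h2
      by_contra hne
      refine hz (d z) ⟨p ((γ : SL2R) • z), ⟨p z, Or.inl h1, (hd z).symm⟩, Or.inr h2⟩ hne (hd z)
    refine ⟨d UpperHalfPlane.I, fun z => ?_⟩
    rw [hd z, hloc.apply_eq_of_preconnectedSpace z UpperHalfPlane.I]
  choose r hr using hex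
  refine ⟨MonoidHom.mk' r ?_, hr, ?_⟩
  · intro a b
    apply huniq _ _ (p UpperHalfPlane.I)
    rw [← hr, Subgroup.coe_mul, Subgroup.coe_mul, mul_smul, mul_smul, hr, hr]
  · intro ρ hρ
    ext1 γ
    exact huniq _ _ (p UpperHalfPlane.I) ((hρ γ _).symm.trans (hr γ _))
end

section
/- Characterization of zero translation length: For every A ∈ SL(2,ℝ), the translation length of A vanishes if and only if A is not hyperbolic; that is, ⨅_{z ∈ ℍ} dist(z, A • z) = 0 if and only if |trace A| ≤ 2. -/
open UpperHalfPlane Matrix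

local notation "SL2R" => Matrix.SpecialLinearGroup (Fin 2) ℝ

/-- Explicit displacement formula. -/
lemma displacement_formula (A : SL2R) (z : ℍ) :
    (2 * Real.sinh (dist z (A • z) / 2)) ^ 2 * z.im ^ 2 =
      (A 1 0 * (z.re ^ 2 - z.im ^ 2) + (A 1 1 - A 0 0) * z.re - A 0 1) ^ 2
        + z.im ^ 2 * (2 * A 1 0 * z.re + A 1 1 - A 0 0) ^ 2 := by
  have hy := z.im_pos
  have hdet : A 0 0 * A 1 1 - A 0 1 * A 1 0 = 1 := by
    have := A.det_coe
    rwa [Matrix.det_fin_two] at this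
  have hw := coe_specialLinearGroup_apply A z
  simp only [Algebra.algebraMap_self, RingHom.id_apply] at hw
  have hden : (A 1 0 : ℂ) * z + A 1 1 ≠ 0 := by
    intro h
    have h1 := congrArg Complex.im h
    have h2 := congrArg Complex.re h
    simp at h1 h2
    rcases h1 with h1 | h1
    · simp [h1] at h2
      simp [h1, h2] at hdet
    · exact hy.ne' h1
  have hN : 0 < Complex.normSq ((A 1 0 : ℂ) * z + A 1 1) := Complex.normSq_pos.2 hden
  have him : (A • z).im * Complex.normSq ((A 1 0 : ℂ) * z + A 1 1) = z.im := by
    rw [← coe_im, hw, Complex.div_im, sub_mul, div_mul_cancel₀ _ hN.ne', div_mul_cancel₀ _ hN.ne']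
    simp
    linear_combination z.im * hdet
  have hd : dist (z : ℂ) (A • z : ℍ) ^ 2 * Complex.normSq ((A 1 0 : ℂ) * z + A 1 1) =
      Complex.normSq (z * ((A 1 0 : ℂ) * z + A 1 1) - ((A 0 0 : ℂ) * z + A 0 1)) := by
    rw [Complex.dist_eq, Complex.sq_norm, ← Complex.normSq_mul, hw]
    congr 1
    rw [sub_mul, div_mul_cancel₀ _ hden]
  have hP : Complex.normSq (z * ((A 1 0 : ℂ) * z + A 1 1) - ((A 0 0 : ℂ) * z + A 0 1)) =
      (A 1 0 * (z.re ^ 2 - z.im ^ 2) + (A 1 1 - A 0 0) * z.re - A 0 1) ^ 2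
        + z.im ^ 2 * (2 * A 1 0 * z.re + A 1 1 - A 0 0) ^ 2 := by
    simp [Complex.normSq_apply]
    ring
  rw [← hP, ← hd, sinh_half_dist, mul_pow, div_pow, mul_pow, Real.sq_sqrt (by positivity)]
  have hy' := (A • z).im_pos
  field_simp
  rw [← him]
  ring

theorem translation_length_eq_zero_iff_abs_trace_le_two (A : SL2R) :
    (⨅ z : ℍ, dist z (A • z)) = 0 ↔
      |Matrix.trace (A : Matrix (Fin 2) (Fin 2) ℝ)| ≤ 2 := by
  have hdet : A 0 0 * A 1 1 - A 0 1 * A 1 0 = 1 := by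
    have := A.det_coe
    rwa [Matrix.det_fin_two] at this
  rw [Matrix.trace_fin_two]
  have hbdd : BddBelow (Set.range fun z : ℍ => dist z (A • z)) :=
    ⟨0, by rintro _ ⟨z, rfl⟩; exact dist_nonneg⟩
  have key := displacement_formula A
  have hsh : ∀ z : ℍ, 0 ≤ Real.sinh (dist z (A • z) / 2) := fun z =>
    Real.sinh_nonneg_iff.2 (by positivity)
  generalize A 0 0 = a at *
  generalize A 0 1 = b at *
  generalize A 1 0 = c at *
  generalize A 1 1 = d at *
  constructor
  · intro h
    by_contra! hlt
    have ht : 4 < (a + d) ^ 2 := by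
      rw [← sq_abs]; nlinarith
    have hs : 0 < √((a + d) ^ 2 - 4) := Real.sqrt_pos.2 (by linarith)
    have hpos : 0 < 2 * Real.arsinh (√((a + d) ^ 2 - 4) / 2) := by
      have := Real.arsinh_pos_iff.2 (half_pos hs)
      linarith
    have : 2 * Real.arsinh (√((a + d) ^ 2 - 4) / 2) ≤ ⨅ z : ℍ, dist z (A • z) := by
      apply le_ciInf
      intro z
      have h1 : √((a + d) ^ 2 - 4) ≤ 2 * Real.sinh (dist z (A • z) / 2) := by
        apply Real.sqrt_le_iff.2 ⟨by linarith [hsh z], ?_⟩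
        have hy : 0 < z.im ^ 2 := pow_pos z.im_pos 2
        refine le_of_mul_le_mul_right ?_ hy
        rw [key z]
        have := sq_nonneg (c * z.re ^ 2 + (d - a) * z.re - b + c * z.im ^ 2)
        linear_combination this + 4 * z.im ^ 2 * hdet
      have h2 : Real.arsinh (√((a + d) ^ 2 - 4) / 2) ≤ dist z (A • z) / 2 := by
        rw [← Real.sinh_le_sinh, Real.sinh_arsinh]
        linarith
      linarith
    linarith
  · intro h
    have ht : (a + d) ^ 2 ≤ 4 := by
      have := (sq_le_sq' (by linarith [abs_nonneg (a + d)]) h)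
      rw [sq_abs] at this; linarith
    apply le_antisymm _ (Real.iInf_nonneg fun z => dist_nonneg)
    apply le_of_forall_pos_le_add
    intro ε hε
    rw [zero_add]
    suffices hz : ∃ z : ℍ, (2 * Real.sinh (dist z (A • z) / 2)) ^ 2 * z.im ^ 2
        ≤ ε ^ 2 * z.im ^ 2 by
      obtain ⟨z, hz⟩ := hz
      apply (ciInf_le hbdd z).trans
      have h1 := le_of_mul_le_mul_right hz (pow_pos z.im_pos 2)
      have h2 := abs_le_of_sq_le_sq h1 hε.le
      have h3 : dist z (A • z) / 2 ≤ Real.sinh (dist z (A • z) / 2) :=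
        Real.self_le_sinh_iff.2 (by positivity)
      linarith [le_abs_self (2 * Real.sinh (dist z (A • z) / 2))]
    by_cases hc : c = 0
    · subst hc
      have had : d = a := by nlinarith [sq_nonneg (a - d)]
      refine ⟨⟨⟨0, |b| / ε + 1⟩, by show 0 < |b| / ε + 1; positivity⟩, ?_⟩
      rw [key]
      have e1 : ∀ h, (UpperHalfPlane.mk ⟨0, |b| / ε + 1⟩ h).im = |b| / ε + 1 := fun _ => rfl
      have e2 : ∀ h, (UpperHalfPlane.mk ⟨0, |b| / ε + 1⟩ h).re = 0 := fun _ => rfl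
      have e3 : ε * (|b| / ε + 1) = |b| + ε * 1 := by field_simp
      rw [e1, e2, had, ← mul_pow ε, e3]
      have : b ^ 2 ≤ (|b| + ε * 1) ^ 2 := by
        rw [← sq_abs b]; gcongr; linarith
      linarith
    · have hc2 : 0 < c ^ 2 := by positivity
      set δ := ε / |c| with hδ
      have hδ0 : 0 < δ := by positivity
      have hcδ : c ^ 2 * δ ^ 2 = ε ^ 2 := by
        rw [hδ, div_pow, sq_abs]; field_simp
      set q := (4 - (a + d) ^ 2) / (4 * c ^ 2) with hq
      have hq0 : 0 ≤ q := div_nonneg (by linarith) (by positivity)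
      have hqc : c * c * q = (4 - (a + d) ^ 2) / 4 := by rw [hq]; field_simp
      have hy : 0 < √(q + δ ^ 2) := Real.sqrt_pos.2 (by positivity)
      have hysq : √(q + δ ^ 2) ^ 2 = q + δ ^ 2 := Real.sq_sqrt (by positivity)
      refine ⟨⟨⟨(a - d) / (2 * c), √(q + δ ^ 2)⟩, hy⟩, ?_⟩
      rw [key]
      have e1 : ∀ h, (UpperHalfPlane.mk ⟨(a - d) / (2 * c), √(q + δ ^ 2)⟩ h).im
        = √(q + δ ^ 2) := fun _ => rfl
      have e2 : ∀ h, (UpperHalfPlane.mk ⟨(a - d) / (2 * c), √(q + δ ^ 2)⟩ h).re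
        = (a - d) / (2 * c) := fun _ => rfl
      rw [e1, e2, hysq]
      have e3 : 2 * c * ((a - d) / (2 * c)) + d - a = 0 := by field_simp; ring
      have e4 : c * (((a - d) / (2 * c)) ^ 2 - (q + δ ^ 2)) + (d - a) * ((a - d) / (2 * c)) - b
          = - (c * δ ^ 2) := by
        apply mul_left_cancel₀ hc
        have : c * ((a - d) / (2 * c)) = (a - d) / 2 := by field_simp
        generalize (a - d) / (2 * c) = x at *
        linear_combination (c * x + (a - d) / 2 + (d - a)) * this - hqc + hdet
      rw [e3, e4, ← hcδ]
      have : 0 ≤ c ^ 2 * δ ^ 2 * q := by positivity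
      linarith
end

section
/- Finiteness of the commensurator when the representation has a kernel: Let Γ ≤ SL(2,ℝ) be a lattice, ρ : Γ → SL(2,ℝ) a group homomorphism, and p : ℍ → ℍ a nonconstant holomorphic ρ-equivariant map. Assume ρ has a nontrivial kernel on ℍ: there exists γ ∈ Γ acting nontrivially on ℍ (γ ≠ ±I) such that ρ(γ) acts trivially on ℍ (ρ(γ) = ±I). Define the commensurator set C = {h ∈ SL(2,ℝ) : ∃ g ∈ SL(2,ℝ), ∃ a subgroup Γ' of SL(2,ℝ) with Γ' ≤ Γ, Γ' ≤ hΓh⁻¹, Γ' of finite index in Γ and of finite index in hΓh⁻¹, such that for all γ' ∈ Γ' and all w ∈ ℍ one has ρ(γ') • w = (g · ρ(h⁻¹γ'h) · g⁻¹) • w}. Then C is contained in finitely many left cosets of Γ: there exists a finite set F ⊆ SL(2,ℝ) such that every h ∈ C can be written h = f·γ with f ∈ F and γ ∈ Γ. -/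
open UpperHalfPlane MeasureTheory Matrix Filter Topology

local notation "SL2R" => Matrix.SpecialLinearGroup (Fin 2) ℝ

noncomputable instance : TopologicalSpace SL2R := instTopologicalSpaceSubtype
noncomputable instance : MeasurableSpace ℍ := borel ℍ
instance : BorelSpace ℍ := ⟨rfl⟩

/-- The hyperbolic volume measure on the upper half-plane `ℍ`, i.e. the measure with
density `1 / (Im z)^2` with respect to the planar Lebesgue measure. -/
noncomputable def hypVolume : Measure ℍ :=
  ((volume : Measure ℂ).comap UpperHalfPlane.coe).withDensity
    fun z => ENNReal.ofReal (1 / z.im ^ 2)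

/-- A map `p : ℍ → ℍ` is holomorphic if `z ↦ (p z : ℂ)` is complex differentiable
at every point of the (open) upper half-plane. -/
def IsHolomorphicMap (p : ℍ → ℍ) : Prop :=
  DifferentiableOn ℂ
    (fun z : ℂ => if hz : 0 < z.im then ((p ⟨z, hz⟩ : ℂ)) else 0)
    {z : ℂ | 0 < z.im}

/-- A lattice in `SL(2, ℝ)`: a discrete subgroup whose action on `ℍ` admits a measurable
fundamental domain of finite hyperbolic volume. -/
def IsLattice (Γ : Subgroup SL2R) : Prop :=
  DiscreteTopology Γ ∧
    ∃ F : Set ℍ, MeasurableSet F ∧ IsFundamentalDomain Γ F hypVolume ∧ hypVolume F < ⊤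

/-- The commensurator set of a modular embedding `(p, ρ)`: elements `h ∈ SL(2,ℝ)` such that
for some `g ∈ SL(2,ℝ)`, the homomorphisms `ρ` and `c_g ∘ ρ ∘ c_{h⁻¹}` agree, as Möbius
transformations of `ℍ`, on a common finite-index subgroup `Γ'` of `Γ` and `hΓh⁻¹`. -/
def commSet (Γ : Subgroup SL2R) (ρ : Γ →* SL2R) : Set SL2R :=
  {h : SL2R | ∃ g : SL2R, ∃ Γ' : Subgroup SL2R, ∃ h₁ : Γ' ≤ Γ,
    Γ' ≤ Subgroup.map (MulAut.conj h).toMonoidHom Γ ∧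
    (Γ'.subgroupOf Γ).index ≠ 0 ∧
    (Γ'.subgroupOf (Subgroup.map (MulAut.conj h).toMonoidHom Γ)).index ≠ 0 ∧
    ∀ (γ' : SL2R) (hm : γ' ∈ Γ') (hm2 : h⁻¹ * γ' * h ∈ Γ) (w : ℍ),
      ρ ⟨γ', h₁ hm⟩ • w = (g * ρ ⟨h⁻¹ * γ' * h, hm2⟩ * g⁻¹) • w}

open scoped ENNReal NNReal

lemma borel_eq_mathlib : (borel ℍ : MeasurableSpace ℍ) = UpperHalfPlane.instMeasurableSpace :=
  (borel_comap).symm ▸ rfl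

/-- The measure of `hypVolume`, for an arbitrary sigma-algebra. -/
noncomputable def hypVolGen (m : MeasurableSpace ℍ) : @Measure ℍ m :=
  @Measure.withDensity ℍ m (@Measure.comap ℍ ℂ m _ UpperHalfPlane.coe volume)
    fun z => ENNReal.ofReal (1 / z.im ^ 2)

lemma hypInv_aux (m : MeasurableSpace ℍ) (hm : m = UpperHalfPlane.instMeasurableSpace) :
    @SMulInvariantMeasure SL2R ℍ _ m (hypVolGen m) ∧
    @SigmaFinite ℍ m (hypVolGen m) ∧
    @IsFiniteMeasureOnCompacts ℍ m _ (hypVolGen m) := by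
  subst hm
  have h : hypVolGen UpperHalfPlane.instMeasurableSpace =
      @volume ℍ UpperHalfPlane.instMeasureSpace := by
    rw [UpperHalfPlane.volume_def]
    unfold hypVolGen
    congr 1
    ext z
    rw [ENNReal.ofReal]
    congr 1
    ext
    rw [Real.coe_toNNReal _ (by positivity)]
    simp
  refine ⟨?_, ?_, ?_⟩
  · rw [h]
    constructor
    intro c s hs
    have := (inferInstance : @SMulInvariantMeasure (GL (Fin 2) ℝ) ℍ _ _
      (@volume ℍ UpperHalfPlane.instMeasureSpace))
    exact this.measure_preimage_smul (Matrix.SpecialLinearGroup.mapGL ℝ c) hs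
  · rw [h]; infer_instance
  · rw [h]; infer_instance

instance hypInv : SMulInvariantMeasure SL2R ℍ hypVolume := (hypInv_aux _ borel_eq_mathlib).1
instance hypSig : SigmaFinite hypVolume := (hypInv_aux _ borel_eq_mathlib).2.1
instance hypFin : IsFiniteMeasureOnCompacts hypVolume := (hypInv_aux _ borel_eq_mathlib).2.2

lemma topEq : (instTopologicalSpaceSubtype : TopologicalSpace SL2R) =
  Matrix.SpecialLinearGroup.instTopologicalSpace := rfl

instance slTopGroup : IsTopologicalGroup SL2R :=
  (inferInstance : @IsTopologicalGroup SL2R Matrix.SpecialLinearGroup.instTopologicalSpace _)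
instance slT2 : T2Space SL2R :=
  (inferInstance : @T2Space SL2R Matrix.SpecialLinearGroup.instTopologicalSpace)
instance slContSMul : ContinuousSMul SL2R ℍ := UpperHalfPlane.instContinuousSMulSL2R
instance slSC : SecondCountableTopology SL2R :=
  have : SecondCountableTopology (Matrix (Fin 2) (Fin 2) ℝ) :=
    inferInstanceAs (SecondCountableTopology (Fin 2 → Fin 2 → ℝ))
  TopologicalSpace.Subtype.secondCountableTopology {A : Matrix (Fin 2) (Fin 2) ℝ | A.det = 1}
instance slPD (Γ : Subgroup SL2R) [h : DiscreteTopology Γ] :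
    ProperlyDiscontinuousSMul Γ ℍ :=
  @UpperHalfPlane.instProperlyDiscontinuousSL2RSubgroup Γ h

lemma countable_of_discrete (Γ : Subgroup SL2R) [DiscreteTopology Γ] : Countable Γ := by
  have : SecondCountableTopology Γ :=
    TopologicalSpace.Subtype.secondCountableTopology (Γ : Set SL2R)
  exact TopologicalSpace.separableSpace_iff_countable.1 inferInstance

/-- Hyperbolic area of a unit ball. -/
noncomputable def ballVol : ℝ≥0∞ := hypVolume (Metric.ball UpperHalfPlane.I 1)

/-- (Unnormalised) average over the hyperbolic ball of radius one. -/
noncomputable def ballInt (f : ℍ → ℝ≥0∞) (z : ℍ) : ℝ≥0∞ :=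
  ∫⁻ w in Metric.ball z 1, f w ∂hypVolume

lemma ballInt_smul (g : SL2R) (f : ℍ → ℝ≥0∞) (z : ℍ) :
    ballInt f (g • z) = ballInt (fun w => f (g • w)) z := by
  unfold ballInt
  have h := (measurePreserving_smul g hypVolume).setLIntegral_comp_emb
    (measurableEmbedding_const_smul g) f (Metric.ball z 1)
  rw [h]
  congr 2
  rw [Set.image_smul, Metric.smul_ball]

lemma hypVolume_ball (z : ℍ) : hypVolume (Metric.ball z 1) = ballVol := by
  obtain ⟨g, rfl⟩ := MulAction.exists_smul_eq SL2R UpperHalfPlane.I z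
  rw [ballVol, ← Metric.smul_ball, measure_smul]

lemma ballVol_ne_top : ballVol ≠ ⊤ := by
  have : hypVolume (Metric.closedBall UpperHalfPlane.I 1) < ⊤ :=
    (isCompact_closedBall _ _).measure_lt_top
  exact ((measure_mono Metric.ball_subset_closedBall).trans_lt this).ne

lemma hypVolume_pos_of_isOpen {U : Set ℍ} (hU : IsOpen U) (hne : U.Nonempty) :
    hypVolume U ≠ 0 := by
  unfold hypVolume
  intro h
  rw [withDensity_apply_eq_zero' (by fun_prop)] at h
  have h1 : {x : ℍ | ENNReal.ofReal (1 / x.im ^ 2) ≠ 0} = Set.univ := by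
    ext z
    simp [z.im_pos.ne']
  rw [h1, Set.univ_inter, UpperHalfPlane.isOpenEmbedding_coe.measurableEmbedding.comap_apply] at h
  exact (UpperHalfPlane.isOpenEmbedding_coe.isOpenMap _ hU).measure_ne_zero _ (hne.image _) h

lemma ballVol_ne_zero : ballVol ≠ 0 :=
  hypVolume_pos_of_isOpen Metric.isOpen_ball ⟨UpperHalfPlane.I, by simp⟩

lemma setLIntegral_ballInt (Γ : Subgroup SL2R) [Countable Γ] {F : Set ℍ}
    (hF : IsFundamentalDomain Γ F hypVolume)
    (f : ℍ → ℝ≥0∞) (hf : Measurable f) (hinv : ∀ (γ : Γ) z, f ((γ : SL2R) • z) = f z) :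
    ∫⁻ z in F, ballInt f z ∂hypVolume = ballVol * ∫⁻ z in F, f z ∂hypVolume := by
  obtain ⟨k, hk⟩ : ∃ k : ℍ → ℍ → ℝ≥0∞,
    k = fun z w => (Metric.ball z 1).indicator (fun _ => (1 : ℝ≥0∞)) w := ⟨_, rfl⟩
  have hkm : Measurable (fun x : ℍ × ℍ => k x.1 x.2) := by
    have : (fun x : ℍ × ℍ => k x.1 x.2) = ({x : ℍ × ℍ | dist x.2 x.1 < 1}).indicator (fun _ => 1) := by
      ext ⟨z, w⟩
      simp [hk, Set.indicator]
    rw [this]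
    refine measurable_const.indicator ?_
    exact (isOpen_lt (by fun_prop) (by fun_prop)).measurableSet
  have hms : ∀ g : Γ, Measurable (fun z : ℍ => g • z) := fun g =>
    measurable_const_smul (g : SL2R)
  have hkg : ∀ (g : Γ) z w, k z (g • w) = k (g⁻¹ • z) w := by
    intro g z w
    have : dist (g • w) z = dist w (g⁻¹ • z) := by
      rw [← dist_smul (g : SL2R) w (g⁻¹ • z), ← Subgroup.smul_def, ← Subgroup.smul_def,
        smul_inv_smul]
    simp [hk, Set.indicator, this]
  have hks : ∀ w, ∫⁻ z, k z w ∂hypVolume = ballVol := by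
    intro w
    have : (fun z => k z w) = (Metric.ball w 1).indicator (fun _ => 1) := by
      ext z
      simp [hk, Set.indicator, dist_comm]
    rw [this, lintegral_indicator_const Metric.isOpen_ball.measurableSet, hypVolume_ball, one_mul]
  have h1 : ∀ z, ballInt f z = ∑' g : Γ, ∫⁻ w in F, k (g⁻¹ • z) w * f w ∂hypVolume := by
    intro z
    have : ballInt f z = ∫⁻ w, k z w * f w ∂hypVolume := by
      rw [ballInt, ← lintegral_indicator Metric.isOpen_ball.measurableSet]
      congr 1
      ext w
      simp [hk, Set.indicator]
    rw [this, hF.lintegral_eq_tsum'']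
    congr 1
    ext g
    congr 1
    ext w
    rw [hkg, Subgroup.smul_def g w, hinv]
  have hm : ∀ g : Γ, Measurable (fun x : ℍ × ℍ => k (g⁻¹ • x.1) x.2 * f x.2) := by
    intro g
    refine Measurable.mul ?_ (hf.comp measurable_snd)
    have h3 : Measurable (fun x : ℍ × ℍ => (g⁻¹ • x.1, x.2)) :=
      ((hms g⁻¹).comp measurable_fst).prodMk measurable_snd
    exact hkm.comp h3
  simp_rw [h1]
  rw [lintegral_tsum (fun g => ((hm g).lintegral_prod_right').aemeasurable)]
  have h2 : ∀ g : Γ, ∫⁻ z in F, ∫⁻ w in F, k (g⁻¹ • z) w * f w ∂hypVolume ∂hypVolume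
      = ∫⁻ w in F, (∫⁻ z in F, k (g⁻¹ • z) w ∂hypVolume) * f w ∂hypVolume := by
    intro g
    rw [lintegral_lintegral_swap (hm g).aemeasurable]
    congr 1
    ext w
    rw [lintegral_mul_const]
    have h3 : Measurable (fun x : ℍ => (g⁻¹ • x, w)) := (hms g⁻¹).prodMk measurable_const
    exact hkm.comp h3
  simp_rw [h2]
  have hm2 : ∀ g : Γ, Measurable fun w => ∫⁻ z in F, k (g⁻¹ • z) w ∂hypVolume := by
    intro g
    have h3 : Measurable (fun x : ℍ × ℍ => (g⁻¹ • x.1, x.2)) :=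
      ((hms g⁻¹).comp measurable_fst).prodMk measurable_snd
    refine Measurable.lintegral_prod_left' (f := fun x : ℍ × ℍ => k (g⁻¹ • x.1) x.2) ?_
    exact hkm.comp h3
  have h4 := lintegral_tsum (μ := hypVolume.restrict F)
    (f := fun (g : Γ) w => (∫⁻ z in F, k (g⁻¹ • z) w ∂hypVolume) * f w)
    (fun g => ((hm2 g).mul hf).aemeasurable)
  rw [← h4, ← lintegral_const_mul _ hf]
  congr 1
  ext w
  rw [ENNReal.tsum_mul_right, ← hF.lintegral_eq_tsum' (fun z => k z w), hks]

/-- A function on the upper half plane is holomorphic. -/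
def HolFun (H : ℍ → ℂ) : Prop :=
  DifferentiableOn ℂ (fun z : ℂ => H (ofComplex z)) {z : ℂ | 0 < z.im}

lemma HolFun.differentiableAt {H : ℍ → ℂ} (hH : HolFun H) {z : ℂ} (hz : 0 < z.im) :
    DifferentiableAt ℂ (fun z : ℂ => H (ofComplex z)) z :=
  (hH z hz).differentiableAt (isOpen_upperHalfPlaneSet.mem_nhds hz)

lemma HolFun.continuous {H : ℍ → ℂ} (hH : HolFun H) : Continuous H := by
  have h1 := hH.continuousOn
  rw [continuous_iff_continuousAt]
  intro z
  have h2 := (hH.differentiableAt z.im_pos).continuousAt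
  have h3 : H = (fun z : ℂ => H (ofComplex z)) ∘ UpperHalfPlane.coe := by
    ext w; simp
  rw [h3]
  exact ContinuousAt.comp h2 UpperHalfPlane.continuous_coe.continuousAt

lemma smul_coe (g : SL2R) (z : ℍ) : ((g • z : ℍ) : ℂ) =
    ((g 0 0 : ℂ) * z + (g 0 1 : ℂ)) / ((g 1 0 : ℂ) * z + (g 1 1 : ℂ)) := by
  rw [UpperHalfPlane.coe_specialLinearGroup_apply]; simp

lemma denom_ne (g : SL2R) (z : ℍ) : ((g 1 0 : ℂ) * z + (g 1 1 : ℂ)) ≠ 0 :=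
  denom_ne_zero (g : GL (Fin 2) ℝ) z

lemma sl_det (g : SL2R) : g 0 0 * g 1 1 - g 0 1 * g 1 0 = 1 := by
  have := g.det_coe
  rwa [Matrix.det_fin_two] at this

lemma smul_im (g : SL2R) (z : ℍ) : (g • z : ℍ).im =
    z.im / Complex.normSq ((g 1 0 : ℂ) * z + (g 1 1 : ℂ)) := by
  have h := sl_det g
  have hne := Complex.normSq_pos.2 (denom_ne g z)
  rw [← UpperHalfPlane.coe_im, smul_coe, Complex.div_im]
  generalize Complex.normSq ((g 1 0 : ℂ) * z + (g 1 1 : ℂ)) = N at *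
  rw [div_sub_div_same]
  congr 1
  simp
  linear_combination z.im * h

lemma HolFun.comp_smul {H : ℍ → ℂ} (hH : HolFun H) (g : SL2R) :
    HolFun (fun z => H (g • z)) := by
  intro z hz
  refine DifferentiableAt.differentiableWithinAt ?_
  set w : ℍ := ⟨z, hz⟩ with hw
  have h1 : DifferentiableAt ℂ (fun z : ℂ => ((g 0 0 : ℂ) * z + (g 0 1 : ℂ)) /
      ((g 1 0 : ℂ) * z + (g 1 1 : ℂ))) z := by
    have := denom_ne g w
    fun_prop (disch := exact this)
  have h2 := hH.differentiableAt (g • w).im_pos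
  have hz' : z = (w : ℂ) := rfl
  rw [smul_coe] at h2
  have h3 := DifferentiableAt.comp z h2 h1
  refine h3.congr_of_eventuallyEq ?_
  filter_upwards [isOpen_upperHalfPlaneSet.mem_nhds hz] with u hu
  simp only [Function.comp]
  congr 1
  have : u = ((⟨u, hu⟩ : ℍ) : ℂ) := rfl
  rw [this, ← smul_coe, ofComplex_apply, ofComplex_apply]

/-- Hyperbolic rotation around `I`. -/
noncomputable def rotI (θ : ℝ) : SL2R :=
  ⟨!![Real.cos (θ / 2), Real.sin (θ / 2); -Real.sin (θ / 2), Real.cos (θ / 2)], by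
    rw [Matrix.det_fin_two_of]; nlinarith [Real.sin_sq_add_cos_sq (θ / 2)]⟩

lemma rotI_smul_I (θ : ℝ) : rotI θ • UpperHalfPlane.I = UpperHalfPlane.I := by
  have h := denom_ne (rotI θ) UpperHalfPlane.I
  ext
  rw [smul_coe, div_eq_iff h]
  simp [rotI]
  linear_combination (Complex.sin (θ / 2)) * Complex.I_mul_I

lemma rotI_smul (θ : ℝ) (w : ℍ) : ((rotI θ • w : ℍ) : ℂ) =
    Complex.I * (1 + Complex.exp (θ * Complex.I) * ((w - Complex.I) / (w + Complex.I))) /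
      (1 - Complex.exp (θ * Complex.I) * ((w - Complex.I) / (w + Complex.I))) := by
  have h := denom_ne (rotI θ) w
  have hw : (w : ℂ) + Complex.I ≠ 0 := by
    intro h0
    have := congrArg Complex.im h0
    simp at this
    linarith [w.im_pos]
  have he : Complex.exp (θ * Complex.I) = (Complex.cos (θ / 2) + Complex.sin (θ / 2) * Complex.I) ^ 2 := by
    rw [Complex.cos_add_sin_I, ← Complex.exp_nat_mul]
    congr 1; push_cast; ring
  have hcs := Complex.sin_sq_add_cos_sq (θ / 2)
  rw [smul_coe]
  simp [rotI] at h ⊢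
  rw [he]
  generalize Complex.cos (θ / 2) = c at *
  generalize Complex.sin (θ / 2) = s at *
  have hcs' : (c + s * Complex.I) * (c - s * Complex.I) = 1 := by
    linear_combination hcs - s ^ 2 * Complex.I_sq
  have hne : (c + s * Complex.I) ≠ 0 := left_ne_zero_of_mul_eq_one hcs'
  have e1 : 1 + (c + s * Complex.I) ^ 2 * ((w - Complex.I) / (w + Complex.I)) =
     (c + s * Complex.I) * (2 * (c * w + s)) / (w + Complex.I) := by
    field_simp
    linear_combination (-(w:ℂ) - Complex.I) * hcs' + (-2 * c * s - 2 * Complex.I * s ^ 2) * Complex.I_sq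
  have e2 : 1 - (c + s * Complex.I) ^ 2 * ((w - Complex.I) / (w + Complex.I)) =
     (c + s * Complex.I) * (2 * Complex.I * (-(s * w) + c)) / (w + Complex.I) := by
    field_simp
    linear_combination (-(w:ℂ) - Complex.I) * hcs'
  rw [e1, e2]
  have hI := Complex.I_ne_zero
  field_simp

lemma norm_cayley_lt (w : ℍ) : ‖((w : ℂ) - Complex.I) / (w + Complex.I)‖ < 1 := by
  have hw : (w : ℂ) + Complex.I ≠ 0 := by
    intro h0
    have := congrArg Complex.im h0
    simp at this
    linarith [w.im_pos]
  rw [norm_div, div_lt_one (norm_pos_iff.2 hw), ← sq_lt_sq₀ (norm_nonneg _) (norm_nonneg _),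
    ← Complex.normSq_eq_norm_sq, ← Complex.normSq_eq_norm_sq, Complex.normSq_apply,
    Complex.normSq_apply]
  simp
  nlinarith [w.im_pos]

lemma im_cayley_inv {u : ℂ} (hu : ‖u‖ < 1) : 0 < (Complex.I * (1 + u) / (1 - u)).im := by
  have h1 : (1 - u) ≠ 0 := by
    intro h
    have : u = 1 := by linear_combination -h
    simp [this] at hu
  have h2 : u.re ^ 2 + u.im ^ 2 < 1 := by
    have := Complex.sq_norm u
    rw [Complex.normSq_apply] at this
    nlinarith [norm_nonneg u]
  rw [Complex.div_im]
  have h3 := Complex.normSq_pos.2 h1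
  rw [div_sub_div_same]
  apply div_pos _ h3
  simp
  nlinarith

lemma integral_rotI {H : ℍ → ℂ} (hH : HolFun H) (w : ℍ) :
    ∫ θ in (0 : ℝ)..2 * Real.pi, H (rotI θ • w) = (2 * Real.pi : ℝ) • H UpperHalfPlane.I := by
  set c : ℂ := ((w : ℂ) - Complex.I) / (w + Complex.I) with hc
  have hc1 : ‖c‖ < 1 := norm_cayley_lt w
  set G : ℂ → ℂ := fun ζ => H (ofComplex (Complex.I * (1 + ζ * c) / (1 - ζ * c))) with hG
  have hball : ∀ ζ ∈ Metric.closedBall (0 : ℂ) |1|, ‖ζ * c‖ < 1 := by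
    intro ζ hζ
    simp at hζ
    rw [norm_mul]
    nlinarith [norm_nonneg c, norm_nonneg ζ]
  have hd : ∀ ζ ∈ Metric.closedBall (0 : ℂ) |1|, DifferentiableAt ℂ G ζ := by
    intro ζ hζ
    have h1 := hball ζ hζ
    have h2 : (1 - ζ * c) ≠ 0 := by
      intro h
      have : ζ * c = 1 := by linear_combination -h
      simp [this] at h1
    have h3 := hH.differentiableAt (im_cayley_inv h1)
    have h4 : DifferentiableAt ℂ (fun ζ : ℂ => Complex.I * (1 + ζ * c) / (1 - ζ * c)) ζ := by
      fun_prop (disch := exact h2)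
    have h5 := DifferentiableAt.comp (g := fun z : ℂ => H (ofComplex z))
      (f := fun ζ : ℂ => Complex.I * (1 + ζ * c) / (1 - ζ * c)) ζ h3 h4
    exact h5
  have hmain := circleAverage_of_differentiable_on_off_countable (f := G) (c := 0) (R := 1)
    Set.countable_empty (fun ζ hζ => (hd ζ hζ).continuousAt.continuousWithinAt)
    (fun ζ hζ => hd ζ (Metric.ball_subset_closedBall hζ.1))
  rw [Real.circleAverage_def] at hmain
  have hG0 : G 0 = H UpperHalfPlane.I := by
    simp only [hG]
    congr 1
    rw [zero_mul, add_zero, sub_zero, mul_one, div_one]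
    exact ofComplex_apply UpperHalfPlane.I
  rw [hG0] at hmain
  rw [← hmain, smul_smul, mul_inv_cancel₀ (by positivity), one_smul]
  congr 1
  ext θ
  simp only [hG]
  congr 1
  have : circleMap 0 1 θ = Complex.exp (θ * Complex.I) := by simp [circleMap]
  rw [this, ← rotI_smul, ofComplex_apply]

lemma continuous_rotI : Continuous rotI := by
  unfold rotI
  refine Continuous.subtype_mk ?_ _
  fun_prop

lemma lintegral_rotI {H : ℍ → ℂ} (hH : HolFun H) (hpos : ∀ z, 0 ≤ (H z).im) (w : ℍ) :
    ∫⁻ θ in Set.Ioc 0 (2 * Real.pi), ENNReal.ofReal (H (rotI θ • w)).im =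
      ENNReal.ofReal (2 * Real.pi) * ENNReal.ofReal (H UpperHalfPlane.I).im := by
  have hcont : Continuous (fun θ => H (rotI θ • w)) :=
    hH.continuous.comp (continuous_rotI.smul continuous_const)
  have h1 : ∫ θ in (0 : ℝ)..2 * Real.pi, (H (rotI θ • w)).im =
      2 * Real.pi * (H UpperHalfPlane.I).im := by
    have h2 := integral_rotI hH w
    have h3 := congrArg Complex.im h2
    rw [intervalIntegral.integral_of_le (by positivity)] at h3 ⊢
    have h4 := integral_im (𝕜 := ℂ) (μ := volume.restrict (Set.Ioc 0 (2 * Real.pi)))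
      (f := fun θ => H (rotI θ • w)) (hcont.integrableOn_Ioc)
    simp at h3 h4
    rw [h4, h3]
  rw [← ENNReal.ofReal_mul (by positivity), ← h1, intervalIntegral.integral_of_le (by positivity),
    ofReal_integral_eq_lintegral_ofReal]
  · exact (Complex.continuous_im.comp hcont).integrableOn_Ioc
  · exact Filter.Eventually.of_forall fun θ => hpos _

/-- Mean value property over hyperbolic balls. -/
lemma ballInt_im {H : ℍ → ℂ} (hH : HolFun H) (hpos : ∀ z, 0 ≤ (H z).im) (z : ℍ) :
    ballInt (fun w => ENNReal.ofReal (H w).im) z = ballVol * ENNReal.ofReal (H z).im := by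
  obtain ⟨g, rfl⟩ := MulAction.exists_smul_eq SL2R UpperHalfPlane.I z
  rw [ballInt_smul]
  have hH' := hH.comp_smul g
  have hpos' : ∀ z, 0 ≤ (H (g • z)).im := fun z => hpos _
  generalize hK : (fun z => H (g • z)) = K at hH'
  have hK' : ∀ z, H (g • z) = K z := fun z => congrFun hK z
  simp only [hK'] at hpos' ⊢
  set f : ℍ → ℝ≥0∞ := fun w => ENNReal.ofReal (K w).im with hf
  have hrot : ∀ θ : ℝ, ballInt f UpperHalfPlane.I =
      ∫⁻ w in Metric.ball UpperHalfPlane.I 1, f (rotI θ • w) ∂hypVolume := by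
    intro θ
    have := ballInt_smul (rotI θ) f UpperHalfPlane.I
    rw [rotI_smul_I] at this
    exact this
  have h2pi : ENNReal.ofReal (2 * Real.pi) ≠ 0 := by
    simp [Real.pi_pos]
  have hfc : Continuous f :=
    ENNReal.continuous_ofReal.comp (Complex.continuous_im.comp hH'.continuous)
  have h1 : ENNReal.ofReal (2 * Real.pi) * ballInt f UpperHalfPlane.I =
      ENNReal.ofReal (2 * Real.pi) * (ballVol * f UpperHalfPlane.I) := by
    calc ENNReal.ofReal (2 * Real.pi) * ballInt f UpperHalfPlane.I
        = ∫⁻ θ in Set.Ioc 0 (2 * Real.pi), ballInt f UpperHalfPlane.I := by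
          rw [setLIntegral_const, Real.volume_Ioc, sub_zero, mul_comm]
      _ = ∫⁻ θ in Set.Ioc 0 (2 * Real.pi),
            ∫⁻ w in Metric.ball UpperHalfPlane.I 1, f (rotI θ • w) ∂hypVolume := by
          congr 1
          ext θ
          exact hrot θ
      _ = ∫⁻ w in Metric.ball UpperHalfPlane.I 1,
            (∫⁻ θ in Set.Ioc 0 (2 * Real.pi), f (rotI θ • w)) ∂hypVolume := by
          refine lintegral_lintegral_swap ?_
          have : Continuous (fun x : ℝ × ℍ => f (rotI x.1 • x.2)) :=
            hfc.comp ((continuous_rotI.comp continuous_fst).smul continuous_snd)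
          exact this.measurable.aemeasurable
      _ = ∫⁻ w in Metric.ball UpperHalfPlane.I 1,
            ENNReal.ofReal (2 * Real.pi) * f UpperHalfPlane.I ∂hypVolume := by
          congr 1
          ext w
          exact lintegral_rotI hH' hpos' w
      _ = _ := by
          rw [setLIntegral_const, hypVolume_ball]
          ring
  exact (ENNReal.mul_right_inj h2pi ENNReal.ofReal_ne_top).1 h1

/-- The Poisson kernel. -/
noncomputable def pk (p : ℍ) (ξ : ℝ) : ℝ := p.im / Complex.normSq ((p : ℂ) - ξ)

lemma sub_real_ne (p : ℍ) (ξ : ℝ) : (p : ℂ) - ξ ≠ 0 := by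
  intro h0
  have := congrArg Complex.im h0
  simp at this
  linarith [p.im_pos]

lemma pk_pos (p : ℍ) (ξ : ℝ) : 0 < pk p ξ :=
  div_pos p.im_pos (Complex.normSq_pos.2 (sub_real_ne p ξ))

lemma continuous_pk : Continuous (fun x : ℍ × ℝ => pk x.1 x.2) := by
  unfold pk
  refine Continuous.div ?_ ?_ ?_
  · exact UpperHalfPlane.continuous_im.comp continuous_fst
  · refine Complex.continuous_normSq.comp ?_
    exact (UpperHalfPlane.continuous_coe.comp continuous_fst).sub
      (Complex.continuous_ofReal.comp continuous_snd)
  · intro x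
    exact (Complex.normSq_pos.2 (sub_real_ne x.1 x.2)).ne'

lemma pk_eq_im (p : ℍ) (ξ : ℝ) : pk p ξ = (-1 / ((p : ℂ) - ξ)).im := by
  rw [Complex.div_im]
  simp [pk]
  ring

lemma pk_smul (g : SL2R) (p : ℍ) (ξ : ℝ) (h : g 1 0 * ξ + g 1 1 ≠ 0) :
    pk (g • p) ((g 0 0 * ξ + g 0 1) / (g 1 0 * ξ + g 1 1)) =
      (g 1 0 * ξ + g 1 1) ^ 2 * pk p ξ := by
  unfold pk
  have hd := denom_ne g p
  have h' : ((g 1 0 : ℂ) * ξ + g 1 1) ≠ 0 := by exact_mod_cast h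
  have hdet : (g 0 0 : ℂ) * g 1 1 - g 0 1 * g 1 0 = 1 := by exact_mod_cast sl_det g
  have e : ((g • p : ℍ) : ℂ) - (((g 0 0 * ξ + g 0 1) / (g 1 0 * ξ + g 1 1) : ℝ) : ℂ) =
      (p - ξ) / (((g 1 0 : ℂ) * p + (g 1 1 : ℂ)) * ((g 1 0 * ξ + g 1 1 : ℝ) : ℂ)) := by
    rw [smul_coe]
    push_cast
    rw [div_sub_div _ _ hd h']
    congr 1
    linear_combination ((p : ℂ) - ξ) * hdet
  rw [e, smul_im, Complex.normSq_div, Complex.normSq_mul, Complex.normSq_ofReal]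
  have h1 := (Complex.normSq_pos.2 hd).ne'
  have h2 := (Complex.normSq_pos.2 (sub_real_ne p ξ)).ne'
  field_simp

/-- The Hellinger integral of two harmonic measures. -/
noncomputable def hell (p q : ℍ) : ℝ≥0∞ := ∫⁻ ξ : ℝ, ENNReal.ofReal √(pk p ξ * pk q ξ)

lemma null_affine (c d : ℝ) (h : c ≠ 0 ∨ d ≠ 0) :
    {ξ : ℝ | c * ξ + d ≠ 0}ᶜ.Finite := by
  by_cases hc : c = 0
  · convert Set.finite_empty
    ext ξ
    simp [hc] at h ⊢
    exact h
  · refine (Set.finite_singleton (-d / c)).subset ?_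
    intro ξ hξ
    simp at hξ ⊢
    field_simp
    linarith

lemma hell_smul (g : SL2R) (p q : ℍ) : hell (g • p) (g • q) = hell p q := by
  have hdet := sl_det g
  set a := g 0 0 with ha
  set b := g 0 1 with hb
  set c := g 1 0 with hc
  set d := g 1 1 with hd
  set s : Set ℝ := {ξ : ℝ | c * ξ + d ≠ 0} with hs
  set φ : ℝ → ℝ := fun ξ => (a * ξ + b) / (c * ξ + d) with hφ
  have hsm : MeasurableSet s := by
    have : IsOpen s := isOpen_ne_fun (by fun_prop) (by fun_prop)
    exact this.measurableSet
  have hsfin : sᶜ.Finite := null_affine c d (by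
    by_contra hcon
    push Not at hcon
    rw [hcon.1, hcon.2] at hdet
    simp at hdet)
  have hder : ∀ x ∈ s, HasDerivWithinAt φ (1 / (c * x + d) ^ 2) s x := by
    intro x hx
    have h1 : HasDerivAt (fun x : ℝ => a * x + b) a x := by
      simpa using ((hasDerivAt_id x).const_mul a).add_const b
    have h2 : HasDerivAt (fun x : ℝ => c * x + d) c x := by
      simpa using ((hasDerivAt_id x).const_mul c).add_const d
    have h3 := h1.div h2 hx
    have h4 : a * (c * x + d) - (a * x + b) * c = 1 := by linear_combination hdet
    rw [h4] at h3
    exact h3.hasDerivWithinAt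
  have hinv : ∀ x ∈ s, (-c * φ x + a) = 1 / (c * x + d) ∧ d * φ x - b = x / (c * x + d) := by
    intro x hx
    have hx' : c * x + d ≠ 0 := hx
    simp only [hφ]
    generalize hE : c * x + d = E at *
    constructor
    · field_simp
      rw [← hE]
      linear_combination hdet
    · field_simp
      rw [← hE]
      linear_combination x * hdet
  have hinj : Set.InjOn φ s := by
    intro x hx y hy hxy
    have h1 := hinv x hx
    have h2 := hinv y hy
    have hx' : c * x + d ≠ 0 := hx
    have hy' : c * y + d ≠ 0 := hy
    rw [hxy] at h1
    have e1 : c * x + d = c * y + d := by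
      have := h1.1.symm.trans h2.1
      rw [div_eq_div_iff hx' hy'] at this
      linarith
    have e2 := h1.2.symm.trans h2.2
    rw [e1, div_left_inj' hy'] at e2
    exact e2
  have himg : (φ '' s)ᶜ.Finite := by
    refine (null_affine (-c) a (by
      by_contra hcon
      push Not at hcon
      have : c = 0 := by linarith [hcon.1]
      rw [this, hcon.2] at hdet
      simp at hdet)).subset ?_
    rw [Set.compl_subset_compl]
    intro y hy
    have hy' : -c * y + a ≠ 0 := hy
    have e : c * ((d * y - b) / (-c * y + a)) + d = 1 / (-c * y + a) := by
      generalize hE : -c * y + a = E at *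
      field_simp
      rw [← hE]
      linear_combination hdet
    refine ⟨(d * y - b) / (-c * y + a), ?_, ?_⟩
    · show c * ((d * y - b) / (-c * y + a)) + d ≠ 0
      rw [e]
      exact one_div_ne_zero hy'
    · simp only [hφ]
      rw [e]
      generalize hE : -c * y + a = E at *
      field_simp
      rw [← hE]
      linear_combination y * hdet
  have hs_ae : s =ᵐ[volume] Set.univ := by
    rw [ae_eq_univ]; exact hsfin.measure_zero _
  have himg_ae : φ '' s =ᵐ[volume] Set.univ := by
    rw [ae_eq_univ]; exact himg.measure_zero _
  unfold hell
  rw [← setLIntegral_univ, ← setLIntegral_congr himg_ae,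
    lintegral_image_eq_lintegral_abs_deriv_mul hsm hder hinj]
  conv_rhs => rw [← setLIntegral_univ, ← setLIntegral_congr hs_ae]
  refine setLIntegral_congr_fun hsm ?_
  intro x hx
  have hx' : c * x + d ≠ 0 := hx
  have hxp : 0 < (c * x + d) ^ 2 := by positivity
  show _ * ENNReal.ofReal √(pk (g • p) (φ x) * pk (g • q) (φ x)) = _
  simp only [hφ, ha, hb, hc, hd]
  rw [pk_smul g p x hx', pk_smul g q x hx', ← ENNReal.ofReal_mul (abs_nonneg _)]
  rw [← hc, ← hd]
  congr 1
  rw [show (c * x + d) ^ 2 * pk p x * ((c * x + d) ^ 2 * pk q x) =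
    ((c * x + d) ^ 2) ^ 2 * (pk p x * pk q x) by ring, Real.sqrt_mul (by positivity),
    Real.sqrt_sq hxp.le, abs_of_pos (by positivity)]
  field_simp

lemma hell_self (p : ℍ) : hell p p = hell UpperHalfPlane.I UpperHalfPlane.I := by
  obtain ⟨g, rfl⟩ := MulAction.exists_smul_eq SL2R UpperHalfPlane.I p
  exact hell_smul g _ _

lemma hell_I : hell UpperHalfPlane.I UpperHalfPlane.I ≠ ⊤ := by
  unfold hell
  have h : ∀ ξ : ℝ, √(pk UpperHalfPlane.I ξ * pk UpperHalfPlane.I ξ) = (1 + ξ ^ 2)⁻¹ := by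
    intro ξ
    rw [Real.sqrt_mul_self (pk_pos _ _).le]
    simp [pk, Complex.normSq_apply]
    ring
  simp only [h]
  exact (integrable_inv_one_add_sq).lintegral_lt_top.ne

/-- A uniform bound for the Hellinger integral. -/
noncomputable def hellBd : ℝ≥0∞ :=
  hell UpperHalfPlane.I UpperHalfPlane.I + hell UpperHalfPlane.I UpperHalfPlane.I

lemma hellBd_ne_top : hellBd ≠ ⊤ := ENNReal.add_ne_top.2 ⟨hell_I, hell_I⟩

lemma hell_le (p q : ℍ) : hell p q ≤ hellBd := by
  unfold hellBd
  nth_rw 1 [← hell_self p]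
  rw [← hell_self q]
  unfold hell
  have hm : Measurable fun ξ : ℝ => ENNReal.ofReal √(pk p ξ * pk p ξ) := by
    have hc : Continuous fun ξ : ℝ => pk p ξ :=
      continuous_pk.comp (Continuous.prodMk continuous_const continuous_id)
    exact (ENNReal.continuous_ofReal.comp
      (Real.continuous_sqrt.comp (hc.mul hc))).measurable
  rw [← lintegral_add_left hm]
  refine lintegral_mono fun ξ => ?_
  have hx := pk_pos p ξ
  have hy := pk_pos q ξ
  rw [← ENNReal.ofReal_add (Real.sqrt_nonneg _) (Real.sqrt_nonneg _)]
  refine ENNReal.ofReal_le_ofReal ?_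
  rw [Real.sqrt_mul_self hx.le, Real.sqrt_mul_self hy.le]
  refine Real.sqrt_le_iff.2 ⟨by positivity, by nlinarith⟩

instance hypOpenPos : Measure.IsOpenPosMeasure hypVolume :=
  ⟨fun _ hU hne => hypVolume_pos_of_isOpen hU hne⟩

lemma holFun_pk {p : ℍ → ℍ} (hp : HolFun (fun z => (p z : ℂ))) (ξ : ℝ) :
    HolFun (fun z => -1 / ((p z : ℂ) - ξ)) := by
  intro z hz
  have h1 := hp z hz
  have h2 := sub_real_ne (p (ofComplex z)) ξ
  exact DifferentiableWithinAt.div (differentiableWithinAt_const _)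
    (h1.sub (differentiableWithinAt_const _)) h2

lemma continuous_of_hol {p : ℍ → ℍ} (hp : HolFun (fun z => (p z : ℂ))) : Continuous p :=
  UpperHalfPlane.isEmbedding_coe.continuous_iff.2 hp.continuous

lemma ballInt_pk {p : ℍ → ℍ} (hp : HolFun (fun z => (p z : ℂ))) (ξ : ℝ) (z : ℍ) :
    ballInt (fun w => ENNReal.ofReal (pk (p w) ξ)) z = ballVol * ENNReal.ofReal (pk (p z) ξ) := by
  have h := ballInt_im (holFun_pk hp ξ) (fun z => by rw [← pk_eq_im]; exact (pk_pos _ _).le) z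
  simpa only [← pk_eq_im] using h

/-- The defect in the weighted AM-GM inequality. -/
noncomputable def defect (x0 y0 x y : ℝ) : ℝ :=
  (√(y0 / x0) * x + √(x0 / y0) * y) / 2 - √(x * y)

lemma sqrt_ratio {x0 y0 : ℝ} (hx : 0 < x0) (hy : 0 < y0) :
    √(y0 / x0) * x0 = √(x0 * y0) ∧ √(x0 / y0) * y0 = √(x0 * y0) := by
  constructor
  · nth_rw 2 [← Real.sqrt_sq hx.le]
    rw [← Real.sqrt_mul (by positivity)]
    congr 1
    field_simp
  · nth_rw 2 [← Real.sqrt_sq hy.le]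
    rw [← Real.sqrt_mul (by positivity)]
    congr 1
    field_simp

lemma defect_eq {x0 y0 x y : ℝ} (hx0 : 0 < x0) (hy0 : 0 < y0) (hx : 0 < x) (hy : 0 < y) :
    defect x0 y0 x y = (√(√(y0 / x0) * x) - √(√(x0 / y0) * y)) ^ 2 / 2 := by
  have h1 : 0 ≤ √(y0 / x0) * x := by positivity
  have h2 : 0 ≤ √(x0 / y0) * y := by positivity
  have h3 : √(√(y0 / x0) * x) * √(√(x0 / y0) * y) = √(x * y) := by
    rw [← Real.sqrt_mul h1]
    congr 1
    rw [show √(y0 / x0) * x * (√(x0 / y0) * y) = (√(y0 / x0) * √(x0 / y0)) * (x * y) by ring,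
      ← Real.sqrt_mul (by positivity), show y0 / x0 * (x0 / y0) = 1 by field_simp]
    simp
  unfold defect
  have := Real.sq_sqrt h1
  have := Real.sq_sqrt h2
  rw [← h3]
  linarith

lemma defect_nonneg {x0 y0 x y : ℝ} (hx0 : 0 < x0) (hy0 : 0 < y0) (hx : 0 < x) (hy : 0 < y) :
    0 ≤ defect x0 y0 x y := by
  rw [defect_eq hx0 hy0 hx hy]; positivity

lemma eq_of_defect {x0 y0 x y : ℝ} (hx0 : 0 < x0) (hy0 : 0 < y0) (hx : 0 < x) (hy : 0 < y)
    (h : defect x0 y0 x y = 0) : y0 * x = x0 * y := by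
  rw [defect_eq hx0 hy0 hx hy] at h
  have h1 : √(√(y0 / x0) * x) = √(√(x0 / y0) * y) := by
    have : (√(√(y0 / x0) * x) - √(√(x0 / y0) * y)) ^ 2 = 0 := by linarith
    linarith [pow_eq_zero_iff (two_ne_zero) |>.1 this]
  rw [Real.sqrt_inj (by positivity) (by positivity)] at h1
  have h2 := congrArg (fun t => √(y0 / x0) * t) h1
  have h3 : √(y0 / x0) * √(x0 / y0) = 1 := by
    rw [← Real.sqrt_mul (by positivity), show y0 / x0 * (x0 / y0) = 1 by field_simp]
    simp
  rw [← mul_assoc, ← mul_assoc, h3, Real.mul_self_sqrt (by positivity)] at h2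
  field_simp at h2
  linarith

section
variable {p q : ℍ → ℍ}

lemma continuous_pk_comp {p : ℍ → ℍ} (hp : Continuous p) :
    Continuous (fun x : ℍ × ℝ => pk (p x.1) x.2) :=
  continuous_pk.comp (Continuous.prodMk (hp.comp continuous_fst) continuous_snd)

lemma continuous_defect (hp : Continuous p) (hq : Continuous q) (z : ℍ) :
    Continuous (fun x : ℍ × ℝ =>
      defect (pk (p z) x.2) (pk (q z) x.2) (pk (p x.1) x.2) (pk (q x.1) x.2)) := by
  have h1 := continuous_pk_comp hp
  have h2 := continuous_pk_comp hq
  have h3 : Continuous (fun x : ℍ × ℝ => pk (p z) x.2) :=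
    h1.comp (Continuous.prodMk continuous_const continuous_snd)
  have h4 : Continuous (fun x : ℍ × ℝ => pk (q z) x.2) :=
    h2.comp (Continuous.prodMk continuous_const continuous_snd)
  have h5 : Continuous (fun x : ℍ × ℝ => pk (q z) x.2 / pk (p z) x.2) :=
    h4.div h3 fun x => (pk_pos _ _).ne'
  have h6 : Continuous (fun x : ℍ × ℝ => pk (p z) x.2 / pk (q z) x.2) :=
    h3.div h4 fun x => (pk_pos _ _).ne'
  unfold defect
  exact (((h5.sqrt.mul h1).add (h6.sqrt.mul h2)).div_const 2).sub (h1.mul h2).sqrt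

lemma measurable_hell (hp : Continuous p) (hq : Continuous q) :
    Measurable (fun z => hell (p z) (q z)) := by
  unfold hell
  have h : Measurable (fun x : ℍ × ℝ => ENNReal.ofReal √(pk (p x.1) x.2 * pk (q x.1) x.2)) :=
    (ENNReal.continuous_ofReal.comp
      ((continuous_pk_comp hp).mul (continuous_pk_comp hq)).sqrt).measurable
  exact h.lintegral_prod_right'

lemma ballInt_hell (hp : HolFun (fun z => (p z : ℂ))) (hq : HolFun (fun z => (q z : ℂ)))
    (z : ℍ) :
    ballInt (fun w => hell (p w) (q w)) z +
      (∫⁻ w in Metric.ball z 1, (∫⁻ ξ : ℝ, ENNReal.ofReal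
        (defect (pk (p z) ξ) (pk (q z) ξ) (pk (p w) ξ) (pk (q w) ξ))) ∂hypVolume) =
      ballVol * hell (p z) (q z) := by
  have cp := continuous_of_hol hp
  have cq := continuous_of_hol hq
  have hm := measurable_hell cp cq
  have h0 : Measurable (fun x : ℍ × ℝ => ENNReal.ofReal √(pk (p x.1) x.2 * pk (q x.1) x.2)) :=
    (ENNReal.continuous_ofReal.comp
      ((continuous_pk_comp cp).mul (continuous_pk_comp cq)).sqrt).measurable
  have hD : Measurable (fun x : ℍ × ℝ => ENNReal.ofReal
      (defect (pk (p z) x.2) (pk (q z) x.2) (pk (p x.1) x.2) (pk (q x.1) x.2))) :=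
    (ENNReal.continuous_ofReal.comp (continuous_defect cp cq z)).measurable
  unfold ballInt
  rw [← lintegral_add_left hm]
  have e1 : ∀ w, hell (p w) (q w) + (∫⁻ ξ : ℝ, ENNReal.ofReal
        (defect (pk (p z) ξ) (pk (q z) ξ) (pk (p w) ξ) (pk (q w) ξ))) =
      ∫⁻ ξ : ℝ, (ENNReal.ofReal √(pk (p w) ξ * pk (q w) ξ) + ENNReal.ofReal
        (defect (pk (p z) ξ) (pk (q z) ξ) (pk (p w) ξ) (pk (q w) ξ))) := by
    intro w
    unfold hell
    rw [lintegral_add_left]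
    exact h0.comp (measurable_const.prodMk measurable_id)
  simp only [e1]
  rw [lintegral_lintegral_swap (h0.add hD).aemeasurable]
  unfold hell
  rw [← lintegral_const_mul' _ _ ballVol_ne_top]
  congr 1
  ext ξ
  have hX0 := pk_pos (p z) ξ
  have hY0 := pk_pos (q z) ξ
  have e2 : ∀ w, ENNReal.ofReal √(pk (p w) ξ * pk (q w) ξ) + ENNReal.ofReal
        (defect (pk (p z) ξ) (pk (q z) ξ) (pk (p w) ξ) (pk (q w) ξ)) =
      ENNReal.ofReal (√(pk (q z) ξ / pk (p z) ξ) / 2) * ENNReal.ofReal (pk (p w) ξ) +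
      ENNReal.ofReal (√(pk (p z) ξ / pk (q z) ξ) / 2) * ENNReal.ofReal (pk (q w) ξ) := by
    intro w
    have hX := pk_pos (p w) ξ
    have hY := pk_pos (q w) ξ
    rw [← ENNReal.ofReal_add (Real.sqrt_nonneg _) (defect_nonneg hX0 hY0 hX hY),
      ← ENNReal.ofReal_mul (by positivity), ← ENNReal.ofReal_mul (by positivity),
      ← ENNReal.ofReal_add (by positivity) (by positivity)]
    congr 1
    unfold defect
    ring
  simp only [e2]
  have hmX : Measurable (fun w => ENNReal.ofReal (pk (p w) ξ)) :=
    (ENNReal.continuous_ofReal.comp ((continuous_pk_comp cp).comp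
      (Continuous.prodMk continuous_id continuous_const))).measurable
  have bp := ballInt_pk hp ξ z
  have bq := ballInt_pk hq ξ z
  unfold ballInt at bp bq
  rw [lintegral_add_left (hmX.const_mul _), lintegral_const_mul' _ _ ENNReal.ofReal_ne_top,
    lintegral_const_mul' _ _ ENNReal.ofReal_ne_top, bp, bq,
    mul_left_comm, mul_left_comm _ ballVol, ← mul_add,
    ← ENNReal.ofReal_mul (by positivity), ← ENNReal.ofReal_mul (by positivity),
    ← ENNReal.ofReal_add (by positivity) (by positivity)]
  congr 2
  have := sqrt_ratio hX0 hY0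
  linarith [this.1, this.2]

lemma ballInt_hell_le (hp : HolFun (fun z => (p z : ℂ))) (hq : HolFun (fun z => (q z : ℂ)))
    (z : ℍ) : ballInt (fun w => hell (p w) (q w)) z ≤ ballVol * hell (p z) (q z) := by
  rw [← ballInt_hell hp hq z]
  exact le_self_add

lemma ballInt_hell_eq (hp : HolFun (fun z => (p z : ℂ))) (hq : HolFun (fun z => (q z : ℂ)))
    (z : ℍ) (h : ballInt (fun w => hell (p w) (q w)) z = ballVol * hell (p z) (q z)) :
    ∀ w ∈ Metric.ball z 1, ∀ ξ : ℝ, pk (q z) ξ * pk (p w) ξ = pk (p z) ξ * pk (q w) ξ := by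
  have cp := continuous_of_hol hp
  have cq := continuous_of_hol hq
  have hDc := continuous_defect cp cq z
  have hD : Measurable (fun x : ℍ × ℝ => ENNReal.ofReal
      (defect (pk (p z) x.2) (pk (q z) x.2) (pk (p x.1) x.2) (pk (q x.1) x.2))) :=
    (ENNReal.continuous_ofReal.comp hDc).measurable
  have h1 := ballInt_hell hp hq z
  rw [h] at h1
  have hfin : ballVol * hell (p z) (q z) ≠ ⊤ :=
    ENNReal.mul_ne_top ballVol_ne_top ((hell_le _ _).trans_lt hellBd_ne_top.lt_top).ne
  have h2 : (∫⁻ w in Metric.ball z 1, (∫⁻ ξ : ℝ, ENNReal.ofReal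
        (defect (pk (p z) ξ) (pk (q z) ξ) (pk (p w) ξ) (pk (q w) ξ))) ∂hypVolume) = 0 := by
    rw [← add_zero (ballVol * hell (p z) (q z)), add_assoc, zero_add] at h1
    exact (ENNReal.add_right_inj hfin).1 h1
  have h3 := lintegral_prod (μ := hypVolume.restrict (Metric.ball z 1)) (ν := volume) _
    hD.aemeasurable
  rw [h2, lintegral_eq_zero_iff hD] at h3
  have h4 : (hypVolume.restrict (Metric.ball z 1)).prod (volume : Measure ℝ) =
      (hypVolume.prod volume).restrict (Metric.ball z 1 ×ˢ Set.univ) := by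
    conv_lhs => rw [← Measure.restrict_univ (μ := (volume : Measure ℝ))]
    rw [Measure.prod_restrict]
  rw [h4] at h3
  set O : Set (ℍ × ℝ) := (Metric.ball z 1 ×ˢ Set.univ) with hO
  have hOo : IsOpen O := Metric.isOpen_ball.prod isOpen_univ
  set V : Set (ℍ × ℝ) := {x | 0 <
      defect (pk (p z) x.2) (pk (q z) x.2) (pk (p x.1) x.2) (pk (q x.1) x.2)} with hV
  have hVo : IsOpen V := isOpen_lt continuous_const hDc
  have h5 : (hypVolume.prod volume) (O ∩ V) = 0 := by
    have h6 := (ae_restrict_iff' hOo.measurableSet).1 h3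
    refine measure_mono_null ?_ h6
    intro x hx hcon
    have := hcon hx.1
    simp at this
    have h7 : 0 < defect (pk (p z) x.2) (pk (q z) x.2) (pk (p x.1) x.2) (pk (q x.1) x.2) := hx.2
    linarith
  have h6 := (hOo.inter hVo).eq_empty_of_measure_zero h5
  intro w hw ξ
  have h7 : (w, ξ) ∉ O ∩ V := by rw [h6]; simp
  have h8 : ¬ 0 < defect (pk (p z) ξ) (pk (q z) ξ) (pk (p w) ξ) (pk (q w) ξ) := fun hlt =>
    h7 ⟨⟨hw, trivial⟩, hlt⟩
  refine eq_of_defect (pk_pos _ _) (pk_pos _ _) (pk_pos _ _) (pk_pos _ _) ?_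
  exact le_antisymm (not_lt.1 h8)
    (defect_nonneg (pk_pos _ _) (pk_pos _ _) (pk_pos _ _) (pk_pos _ _))

end

lemma poly_aux (C C' : ℂ) (a b c d : ℂ)
    (h : ∀ ξ : ℝ, C * ((a - ξ) * (starRingEnd ℂ a - ξ)) * ((b - ξ) * (starRingEnd ℂ b - ξ)) =
      C' * ((c - ξ) * (starRingEnd ℂ c - ξ)) * ((d - ξ) * (starRingEnd ℂ d - ξ))) (ξ : ℂ) :
    C * ((a - ξ) * (starRingEnd ℂ a - ξ)) * ((b - ξ) * (starRingEnd ℂ b - ξ)) =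
      C' * ((c - ξ) * (starRingEnd ℂ c - ξ)) * ((d - ξ) * (starRingEnd ℂ d - ξ)) := by
  open Polynomial in
  have key : (Polynomial.C C * ((Polynomial.C a - X) * (Polynomial.C (starRingEnd ℂ a) - X)) *
      ((Polynomial.C b - X) * (Polynomial.C (starRingEnd ℂ b) - X)) : ℂ[X]) =
      Polynomial.C C' * ((Polynomial.C c - X) * (Polynomial.C (starRingEnd ℂ c) - X)) *
      ((Polynomial.C d - X) * (Polynomial.C (starRingEnd ℂ d) - X)) := by
    refine Polynomial.eq_of_infinite_eval_eq _ _ ?_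
    refine (Set.infinite_range_of_injective Complex.ofReal_injective).mono ?_
    rintro _ ⟨x, rfl⟩
    have := h x
    simpa using this
  have := congrArg (Polynomial.eval ξ) key
  simpa using this

lemma conj_sub_ne (a b : ℍ) : starRingEnd ℂ (a : ℂ) - b ≠ 0 := by
  intro h0
  have := congrArg Complex.im h0
  simp at this
  linarith [a.im_pos, b.im_pos]

lemma pk_rigid (p0 q0 p q : ℍ) (h : ∀ ξ : ℝ, pk q0 ξ * pk p ξ = pk p0 ξ * pk q ξ) :
    p = q ∨ (p = p0 ∧ q = q0) := by
  have h1 : ∀ ξ : ℝ, ((q0.im * p.im : ℝ) : ℂ) *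
      (((p0 : ℂ) - ξ) * (starRingEnd ℂ (p0 : ℂ) - ξ)) * ((q - ξ) * (starRingEnd ℂ (q : ℂ) - ξ)) =
      ((p0.im * q.im : ℝ) : ℂ) *
      (((q0 : ℂ) - ξ) * (starRingEnd ℂ (q0 : ℂ) - ξ)) *
        ((p - ξ) * (starRingEnd ℂ (p : ℂ) - ξ)) := by
    intro ξ
    have e : ∀ a : ℍ, ((a : ℂ) - ξ) * (starRingEnd ℂ (a : ℂ) - ξ) =
        ((Complex.normSq ((a : ℂ) - ξ) : ℝ) : ℂ) := by
      intro a
      rw [← Complex.mul_conj]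
      simp
    have n : ∀ a : ℍ, Complex.normSq ((a : ℂ) - ξ) ≠ 0 := fun a =>
      (Complex.normSq_pos.2 (sub_real_ne a ξ)).ne'
    rw [e, e, e, e]
    norm_cast
    have h2 := h ξ
    unfold pk at h2
    have n1 := n p0
    have n2 := n q0
    have n3 := n p
    have n4 := n q
    generalize Complex.normSq ((p0 : ℂ) - ξ) = N1 at *
    generalize Complex.normSq ((q0 : ℂ) - ξ) = N2 at *
    generalize Complex.normSq ((p : ℂ) - ξ) = N3 at *
    generalize Complex.normSq ((q : ℂ) - ξ) = N4 at *
    field_simp at h2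
    linarith
  have h2 := poly_aux _ _ _ _ _ _ h1
  by_cases hpq : p = q
  · exact Or.inl hpq
  right
  have hne : (p : ℂ) - q ≠ 0 := fun h0 => hpq (UpperHalfPlane.ext (sub_eq_zero.1 h0))
  have hne' : (q : ℂ) - p ≠ 0 := fun h0 => hpq (UpperHalfPlane.ext (sub_eq_zero.1 h0).symm)
  have c1 : ((q0.im * p.im : ℝ) : ℂ) ≠ 0 := by
    exact_mod_cast (mul_pos q0.im_pos p.im_pos).ne'
  have c2 : ((p0.im * q.im : ℝ) : ℂ) ≠ 0 := by
    exact_mod_cast (mul_pos p0.im_pos q.im_pos).ne'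
  constructor
  · have h3 := h2 p
    rw [sub_self (p : ℂ), zero_mul, mul_zero] at h3
    have h4 : (p0 : ℂ) - p = 0 := by
      by_contra hcon
      exact mul_ne_zero (mul_ne_zero c1 (mul_ne_zero hcon (conj_sub_ne p0 p)))
        (mul_ne_zero hne' (conj_sub_ne q p)) h3
    exact UpperHalfPlane.ext (sub_eq_zero.1 h4).symm
  · have h3 := h2 q
    rw [sub_self (q : ℂ), zero_mul, mul_zero] at h3
    have h4 : (q0 : ℂ) - q = 0 := by
      by_contra hcon
      exact mul_ne_zero (mul_ne_zero c2 (mul_ne_zero hcon (conj_sub_ne q0 q)))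
        (mul_ne_zero hne (conj_sub_ne p q)) h3.symm
    exact UpperHalfPlane.ext (sub_eq_zero.1 h4).symm

lemma hol_ident {H K : ℍ → ℂ} (hH : HolFun H) (hK : HolFun K) {U : Set ℍ} (hU : IsOpen U)
    (hne : U.Nonempty) (h : ∀ w ∈ U, H w = K w) : H = K := by
  obtain ⟨z, hz⟩ := hne
  have aH := hH.analyticOnNhd isOpen_upperHalfPlaneSet
  have aK := hK.analyticOnNhd isOpen_upperHalfPlaneSet
  have hpre : IsPreconnected {z : ℂ | 0 < z.im} := (convex_halfSpace_im_gt 0).isPreconnected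
  have hev : (fun z : ℂ => H (ofComplex z)) =ᶠ[𝓝 (z : ℂ)] (fun z : ℂ => K (ofComplex z)) := by
    have hc : ContinuousAt (fun z : ℂ => (ofComplex z : ℍ)) (z : ℂ) :=
      (contMDiffAt_ofComplex (n := 0) z.im_pos).continuousAt
    have : (ofComplex (z : ℂ)) ∈ U := by simpa using hz
    filter_upwards [hc.preimage_mem_nhds (hU.mem_nhds this)] with w hw
    exact h _ hw
  have := aH.eqOn_of_preconnected_of_eventuallyEq aK hpre z.im_pos hev
  ext w
  have h2 := this w.im_pos
  simpa using h2

lemma uniq_ball {p q : ℍ → ℍ} (hp : HolFun (fun z => (p z : ℂ)))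
    (hq : HolFun (fun z => (q z : ℂ))) (hnc : ∃ z₁ z₂ : ℍ, p z₁ ≠ p z₂)
    (z : ℍ) (h : ballInt (fun w => hell (p w) (q w)) z = ballVol * hell (p z) (q z)) :
    p = q := by
  have h1 := ballInt_hell_eq hp hq z h
  have cp := continuous_of_hol hp
  set U : Set ℍ := Metric.ball z 1 ∩ {w | p w ≠ p z} with hU
  have hUo : IsOpen U := Metric.isOpen_ball.inter (isOpen_ne_fun cp continuous_const)
  have hne : U.Nonempty := by
    by_contra hcon
    rw [Set.not_nonempty_iff_eq_empty] at hcon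
    have : (fun w => (p w : ℂ)) = fun _ => (p z : ℂ) := by
      refine hol_ident hp (differentiableOn_const _) (U := Metric.ball z 1) Metric.isOpen_ball
        ⟨z, by simp⟩ ?_
      intro w hw
      by_contra hne
      have : w ∈ U := ⟨hw, fun h => hne (by rw [h])⟩
      rw [hcon] at this
      exact this
    obtain ⟨z₁, z₂, h12⟩ := hnc
    apply h12
    ext
    exact (congrFun this z₁).trans (congrFun this z₂).symm
  have : (fun w => (p w : ℂ)) = fun w => (q w : ℂ) := by
    refine hol_ident hp hq hUo hne ?_
    intro w hw
    rcases pk_rigid _ _ _ _ (h1 w hw.1) with h2 | h2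
    · rw [h2]
    · exact absurd h2.1 hw.2
  ext w
  exact congrFun this w

theorem uniq_thm (Γ : Subgroup SL2R) (hΓ : IsLattice Γ) (Γ' : Subgroup Γ) [Γ'.FiniteIndex]
    {p q : ℍ → ℍ} (hp : HolFun (fun z => (p z : ℂ)))
    (hq : HolFun (fun z => (q z : ℂ))) (hnc : ∃ z₁ z₂ : ℍ, p z₁ ≠ p z₂)
    (heq : ∀ γ ∈ Γ', ∃ σ : SL2R, ∀ z, p ((γ : SL2R) • z) = σ • p z ∧
      q ((γ : SL2R) • z) = σ • q z) : p = q := by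
  obtain ⟨hdisc, F, hFm, hF, hFfin⟩ := hΓ
  haveI : Countable Γ := countable_of_discrete Γ
  by_contra hpq
  obtain ⟨f, hf⟩ : ∃ f : ℍ → ℝ≥0∞, f = fun z => hell (p z) (q z) := ⟨_, rfl⟩
  have hfm : Measurable f := by
    rw [hf]; exact measurable_hell (continuous_of_hol hp) (continuous_of_hol hq)
  have hfb : ∀ z, f z ≤ hellBd := fun z => by rw [hf]; exact hell_le _ _
  have hlt : ∀ z, ballInt f z < ballVol * f z := by
    intro z
    refine lt_of_le_of_ne ?_ ?_
    · rw [hf]; exact ballInt_hell_le hp hq z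
    · intro h
      rw [hf] at h
      exact hpq (uniq_ball hp hq hnc z h)
  have hfinv : ∀ γ ∈ Γ', ∀ z, f ((γ : SL2R) • z) = f z := by
    intro γ hγ z
    obtain ⟨σ, hσ⟩ := heq γ hγ
    rw [hf]
    simp only [(hσ z).1, (hσ z).2, hell_smul]
  haveI : Fintype (Γ ⧸ Γ') := Subgroup.fintypeQuotientOfFiniteIndex
  set r : (Γ ⧸ Γ') → SL2R := fun c => ((Quotient.out c : Γ) : SL2R)⁻¹ with hr
  have hrep : ∀ (g : Γ) z, f (r (g : Γ ⧸ Γ') • z) = f ((g : SL2R)⁻¹ • z) := by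
    intro g z
    obtain ⟨h, hh⟩ := QuotientGroup.mk_out_eq_mul Γ' g
    simp only [hr]
    rw [hh]
    have := hfinv (h : Γ)⁻¹ (Γ'.inv_mem h.2) ((g : SL2R)⁻¹ • z)
    rw [← this, smul_smul]
    simp
  set ft : ℍ → ℝ≥0∞ := fun z => ∑ c : Γ ⧸ Γ', f (r c • z) with hft
  have hmc : ∀ c : Γ ⧸ Γ', Measurable fun z => f (r c • z) := fun c =>
    hfm.comp (measurable_const_smul (r c))
  have hftm : Measurable ft := Finset.measurable_fun_sum _ fun c _ => hmc c
  have hftinv : ∀ (γ : Γ) z, ft ((γ : SL2R) • z) = ft z := by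
    intro γ z
    simp only [hft]
    rw [← Equiv.sum_comp (MulAction.toPerm γ⁻¹ : Equiv.Perm (Γ ⧸ Γ')) (fun c => f (r c • z))]
    refine Finset.sum_congr rfl fun c _ => ?_
    induction c using QuotientGroup.induction_on with
    | H g =>
      rw [hrep]
      show _ = f (r (γ⁻¹ • (g : Γ ⧸ Γ')) • z)
      rw [MulAction.Quotient.smul_coe, hrep, smul_smul]
      simp
  have hftlt : ∀ z, ballInt ft z < ballVol * ft z := by
    intro z
    have e : ballInt ft z = ∑ c : Γ ⧸ Γ', ballInt f (r c • z) := by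
      simp only [ballInt_smul]
      unfold ballInt
      rw [← lintegral_finsetSum _ fun c _ => hmc c]
    rw [e]
    simp only [hft]
    rw [Finset.mul_sum]
    exact ENNReal.sum_lt_sum_of_nonempty ⟨((1 : Γ) : Γ ⧸ Γ'), Finset.mem_univ _⟩
      fun c _ => hlt _
  have h1 := setLIntegral_ballInt Γ hF ft hftm hftinv
  rw [← lintegral_const_mul _ hftm] at h1
  have hF0 : hypVolume F ≠ 0 := hF.measure_ne_zero (by
    intro h
    apply ballVol_ne_zero
    rw [ballVol, h]
    simp)
  have hftb : ∀ z, ft z ≤ Fintype.card (Γ ⧸ Γ') * hellBd := by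
    intro z
    refine (Finset.sum_le_sum fun c _ => hfb (r c • z)).trans ?_
    simp
  have hfin : ∫⁻ z in F, ballInt ft z ∂hypVolume ≠ ⊤ := by
    rw [h1]
    refine ne_of_lt (lt_of_le_of_lt (lintegral_mono fun z =>
      mul_le_mul_right (hftb z) ballVol) ?_)
    rw [setLIntegral_const]
    exact ENNReal.mul_lt_top (ENNReal.mul_lt_top ballVol_ne_top.lt_top
      (ENNReal.mul_lt_top (ENNReal.natCast_lt_top _) hellBd_ne_top.lt_top)) hFfin
  have h2 := lintegral_strict_mono (μ := hypVolume.restrict F) (f := ballInt ft)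
    (g := fun z => ballVol * ft z) (by rwa [Ne, Measure.restrict_eq_zero])
    (hftm.const_mul _).aemeasurable hfin (Filter.Eventually.of_forall hftlt)
  exact h2.ne h1

/-- A discrete overgroup of a lattice contains it with finite index. -/
theorem finite_index_of_discrete (Γ Λ : Subgroup SL2R) (hΓ : IsLattice Γ)
    (hle : Γ ≤ Λ) [DiscreteTopology Λ] :
    ∃ F : Finset SL2R, ∀ h ∈ Λ, ∃ f ∈ F, ∃ γ ∈ Γ, h = f * γ := by
  obtain ⟨hdisc, F, hFm, hF, hFfin⟩ := hΓ
  have : Countable Γ := countable_of_discrete Γ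
  have : Countable Λ := countable_of_discrete Λ
  set K : Set ℍ := Metric.closedBall UpperHalfPlane.I 1 with hK
  set B : Set ℍ := Metric.ball UpperHalfPlane.I 1 with hB
  have hBK : B ⊆ K := Metric.ball_subset_closedBall
  have hS : Set.Finite {l : Λ | ((l • ·) '' K ∩ K).Nonempty} :=
    ProperlyDiscontinuousSMul.finite_disjoint_inter_image (isCompact_closedBall _ _)
      (isCompact_closedBall _ _)
  set S : Set Λ := {l : Λ | ((l • ·) '' K ∩ K).Nonempty} with hSdef
  obtain ⟨b, hb⟩ : ∃ b : ℍ → ℝ≥0∞, b = B.indicator 1 := ⟨_, rfl⟩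
  have hbm : Measurable b := by
    rw [hb]; exact measurable_one.indicator Metric.isOpen_ball.measurableSet
  obtain ⟨m, hm⟩ : ∃ m : ℝ≥0∞, m = ∑' l : Λ, S.indicator 1 l := ⟨_, rfl⟩
  have hmfin : m ≠ ⊤ := by
    rw [hm, tsum_eq_sum (s := hS.toFinset)]
    · refine (ENNReal.sum_lt_top.2 ?_).ne
      intro l _
      refine lt_of_le_of_lt (Set.indicator_le_self' (fun _ _ => zero_le) l) ?_
      simp
    · intro l hl
      refine Set.indicator_of_notMem ?_ _
      simpa using hl
  have hcount : ∀ x : ℍ, ∑' l : Λ, b ((l : SL2R) • x) ≤ m := by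
    intro x
    by_cases hx : ∃ l0 : Λ, (l0 : SL2R) • x ∈ B
    · obtain ⟨l0, hl0⟩ := hx
      rw [← (Equiv.mulRight l0).tsum_eq, hm]
      refine ENNReal.tsum_le_tsum fun l => ?_
      simp only [Equiv.coe_mulRight, Subgroup.coe_mul, mul_smul]
      rw [hb]
      by_cases hl : (l : SL2R) • (l0 : SL2R) • x ∈ B
      · rw [Set.indicator_of_mem hl, Set.indicator_of_mem]
        · simp
        · exact ⟨_, ⟨_, hBK hl0, rfl⟩, hBK hl⟩
      · rw [Set.indicator_of_notMem hl]
        exact zero_le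
    · push Not at hx
      have : ∀ l : Λ, b ((l : SL2R) • x) = 0 := fun l => by
        rw [hb]; exact Set.indicator_of_notMem (hx l) _
      simp [this]
  set Q := Λ ⧸ (Γ.subgroupOf Λ) with hQ
  have : Countable Q := Quotient.countable
  set r : Q → SL2R := fun c => ((Quotient.out c : Λ) : SL2R) with hr
  have hvol : ∀ c : Q, ∑' γ : Γ, ∫⁻ x in F, b ((r c * (γ : SL2R)⁻¹) • x) ∂hypVolume = ballVol := by
    intro c
    have h1 := hF.lintegral_eq_tsum' (fun x => b (r c • x))
    have h2 : ∫⁻ x, b (r c • x) ∂hypVolume = ballVol := by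
      rw [(measurePreserving_smul (r c) hypVolume).lintegral_comp hbm, hb,
        lintegral_indicator_one Metric.isOpen_ball.measurableSet]
      rfl
    rw [← h2, h1]
    refine tsum_congr fun γ => ?_
    refine lintegral_congr fun x => ?_
    rw [Subgroup.smul_def, smul_smul]
    simp
  have hmeas : ∀ g : SL2R, Measurable fun x : ℍ => b (g • x) := fun g =>
    hbm.comp (measurable_const_smul g)
  have hsum : ∑' _ : Q, ballVol ≤ m * hypVolume F := by
    calc ∑' _ : Q, ballVol
        = ∑' c : Q, ∑' γ : Γ, ∫⁻ x in F, b ((r c * (γ : SL2R)⁻¹) • x) ∂hypVolume := by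
          simp only [hvol]
      _ = ∑' cg : Q × Γ, ∫⁻ x in F, b ((r cg.1 * (cg.2 : SL2R)⁻¹) • x) ∂hypVolume := by
          rw [← ENNReal.tsum_prod]
      _ = ∫⁻ x in F, ∑' cg : Q × Γ, b ((r cg.1 * (cg.2 : SL2R)⁻¹) • x) ∂hypVolume := by
          rw [lintegral_tsum]
          exact fun cg => (hmeas _).aemeasurable
      _ ≤ ∫⁻ x in F, m ∂hypVolume := by
          refine lintegral_mono fun x => ?_
          refine le_trans ?_ (hcount x)
          set j : Q × Γ → Λ := fun cg => Quotient.out cg.1 * ⟨(cg.2 : SL2R)⁻¹,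
            Λ.inv_mem (hle cg.2.2)⟩ with hj
          have hinj : Function.Injective j := by
            rintro ⟨c, γ⟩ ⟨c', γ'⟩ h
            simp only [hj] at h
            have hc : c = c' := by
              rw [← QuotientGroup.out_eq' c, ← QuotientGroup.out_eq' c', QuotientGroup.eq]
              rw [Subgroup.mem_subgroupOf]
              have h2 := congrArg (Subtype.val) h
              simp only [Subgroup.coe_mul] at h2
              have h3 : (((Quotient.out c)⁻¹ * Quotient.out c' : Λ) : SL2R) =
                  (γ : SL2R)⁻¹ * (γ' : SL2R) := by
                simp only [Subgroup.coe_mul, Subgroup.coe_inv]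
                rw [inv_mul_eq_iff_eq_mul, ← mul_assoc, h2]
                simp
              rw [h3]
              exact Γ.mul_mem (Γ.inv_mem γ.2) γ'.2
            subst hc
            have h2 := mul_left_cancel h
            have h3 := congrArg Subtype.val h2
            simp only [_root_.inv_inj] at h3
            rw [Prod.mk.injEq]
            exact ⟨rfl, Subtype.ext h3⟩
          have := ENNReal.tsum_comp_le_tsum_of_injective hinj (fun l : Λ => b ((l : SL2R) • x))
          exact this
      _ = m * hypVolume F := by rw [setLIntegral_const]
  have hQfin : Finite Q := by
    by_contra hcon
    rw [not_finite_iff_infinite] at hcon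
    rw [ENNReal.tsum_const_eq_top_of_ne_zero ballVol_ne_zero] at hsum
    exact absurd (top_le_iff.1 hsum) (ENNReal.mul_lt_top hmfin.lt_top hFfin).ne
  have : Fintype Q := Fintype.ofFinite Q
  classical
  refine ⟨Finset.univ.image r, ?_⟩
  intro h hh
  refine ⟨r ((⟨h, hh⟩ : Λ) : Q), Finset.mem_image_of_mem _ (Finset.mem_univ _), ?_⟩
  refine ⟨(r ((⟨h, hh⟩ : Λ) : Q))⁻¹ * h, ?_, by group⟩
  have h1 : ((Quotient.out ((⟨h, hh⟩ : Λ) : Q) : Λ) : Q) = ((⟨h, hh⟩ : Λ) : Q) :=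
    QuotientGroup.out_eq' _
  rw [QuotientGroup.eq, Subgroup.mem_subgroupOf] at h1
  exact h1

lemma holFun_of_isHol {p : ℍ → ℍ} (hp : IsHolomorphicMap p) : HolFun (fun z => (p z : ℂ)) := by
  refine DifferentiableOn.congr hp ?_
  intro z hz
  have hz' : 0 < z.im := hz
  simp only [dif_pos hz']
  rw [ofComplex_apply_of_im_pos hz']

lemma holFun_id : HolFun (fun z : ℍ => (z : ℂ)) := by
  refine DifferentiableOn.congr differentiableOn_id ?_
  intro z hz
  have hz' : 0 < z.im := hz
  rw [ofComplex_apply_of_im_pos hz']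
  rfl

lemma holFun_smul {p : ℍ → ℍ} (hp : HolFun (fun z => (p z : ℂ))) (g : SL2R) :
    HolFun (fun z => ((g • p z : ℍ) : ℂ)) := by
  simp only [smul_coe]
  intro z hz
  have h1 := hp z hz
  have h2 := denom_ne g (p (ofComplex z))
  exact DifferentiableWithinAt.div
    ((h1.const_mul _).add (differentiableWithinAt_const _))
    ((h1.const_mul _).add (differentiableWithinAt_const _)) h2

lemma sl_ext {A B : SL2R} (h00 : A 0 0 = B 0 0) (h01 : A 0 1 = B 0 1) (h10 : A 1 0 = B 1 0)
    (h11 : A 1 1 = B 1 1) : A = B := by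
  ext i j
  fin_cases i <;> fin_cases j <;> assumption

lemma scalar_of {A : SL2R} (h01 : A 0 1 = 0) (h10 : A 1 0 = 0) (h : A 0 0 = A 1 1) :
    A = 1 ∨ A = -1 := by
  have hd := sl_det A
  rw [h01, h, zero_mul, sub_zero] at hd
  rcases mul_self_eq_one_iff.1 hd with h1 | h1
  · left
    exact sl_ext (by simp [h, h1]) (by simp [h01]) (by simp [h10]) (by simp [h1])
  · right
    exact sl_ext (by simp [h, h1]) (by simp [h01]) (by simp [h10]) (by simp [h1])

lemma triv_of_smul {k : SL2R} (h : ∀ z : ℍ, k • z = z) : k = 1 ∨ k = -1 := by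
  have key : ∀ y : ℝ, 0 < y → k 0 1 = - (k 1 0 * y * y) ∧ k 0 0 * y = k 1 1 * y := by
    intro y hy
    set z : ℍ := ⟨y * Complex.I, by simpa using hy⟩ with hz
    have h1 := congrArg UpperHalfPlane.coe (h z)
    rw [smul_coe, div_eq_iff (denom_ne k z)] at h1
    have hzc : (z : ℂ) = y * Complex.I := rfl
    rw [hzc] at h1
    have h2 := congrArg Complex.re h1
    have h3 := congrArg Complex.im h1
    simp at h2 h3
    constructor <;> linarith
  have h1 := key 1 one_pos
  have h2 := key 2 two_pos
  refine scalar_of ?_ ?_ ?_ <;> linarith [h1.1, h1.2, h2.1, h2.2]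

lemma near_pos : ∀ᶠ k : SL2R in 𝓝 1, 0 < k 0 0 := by
  have hc : Continuous fun k : SL2R => k 0 0 := by
    have : Continuous fun k : SL2R => (k : Matrix (Fin 2) (Fin 2) ℝ) := continuous_subtype_val
    exact (continuous_apply 0).comp ((continuous_apply 0).comp this)
  have : Tendsto (fun k : SL2R => k 0 0) (𝓝 1) (𝓝 ((1 : SL2R) 0 0)) := hc.tendsto 1
  exact this.eventually (lt_mem_nhds (by simp))

lemma eq_one_of_pos {k : SL2R} (h : k = 1 ∨ k = -1) (hk : 0 < k 0 0) : k = 1 := by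
  rcases h with h | h
  · exact h
  · rw [h] at hk
    simp at hk
    linarith

/-- The group of deck transformations of a nonconstant holomorphic map is discrete. -/
lemma near_one_deck {p : ℍ → ℍ} (hp : HolFun (fun z => (p z : ℂ)))
    (hnc : ∃ z₁ z₂ : ℍ, p z₁ ≠ p z₂) :
    ∀ᶠ k : SL2R in 𝓝 1, (∀ z, p (k • z) = p z) → k = 1 := by
  set P : ℂ → ℂ := fun z => (p (ofComplex z) : ℂ) with hP
  have hpre : IsPreconnected {z : ℂ | 0 < z.im} := (convex_halfSpace_im_gt 0).isPreconnected
  obtain ⟨z0, hz0⟩ : ∃ z0 : ℍ, deriv P z0 ≠ 0 := by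
    by_contra hcon
    push Not at hcon
    obtain ⟨z₁, z₂, h12⟩ := hnc
    apply h12
    have h1 : Set.EqOn (deriv P) 0 {z : ℂ | 0 < z.im} := fun z hz => hcon ⟨z, hz⟩
    have h2 := isOpen_upperHalfPlaneSet.is_const_of_deriv_eq_zero hpre hp h1
      z₁.im_pos z₂.im_pos
    ext
    simpa [hP] using h2
  have hstrict : HasStrictDerivAt P (deriv P z0) z0 :=
    ((hp.analyticOnNhd isOpen_upperHalfPlaneSet) z0 z0.im_pos).hasStrictDerivAt
  have hV := hstrict.eventually_left_inverse hz0
  have hV' : ∀ᶠ w : ℍ in 𝓝 z0, hstrict.localInverse P (deriv P z0) z0 hz0 (P w) = w :=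
    UpperHalfPlane.continuous_coe.continuousAt.eventually hV
  have hact : Tendsto (fun x : SL2R × ℍ => x.1 • x.2) (𝓝 1 ×ˢ 𝓝 z0) (𝓝 z0) := by
    have : Continuous (fun x : SL2R × ℍ => x.1 • x.2) := continuous_smul
    have h := this.tendsto (1, z0)
    rw [nhds_prod_eq] at h
    simpa using h
  have h1 := hact.eventually hV'
  have h2 : ∀ᶠ x : SL2R × ℍ in (𝓝 1 ×ˢ 𝓝 z0),
      hstrict.localInverse P (deriv P z0) z0 hz0 (P x.2) = x.2 :=
    tendsto_snd.eventually hV'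
  have h3 := (h1.and h2).curry
  filter_upwards [h3, near_pos] with k hk hkpos hdeck
  refine eq_one_of_pos (triv_of_smul ?_) hkpos
  obtain ⟨W, hW, hWo, hzW⟩ := eventually_nhds_iff.1 hk
  have h4 : (fun z : ℍ => ((k • z : ℍ) : ℂ)) = fun z : ℍ => (z : ℂ) := by
    refine hol_ident (holFun_smul holFun_id k) holFun_id hWo ⟨z0, hzW⟩ ?_
    intro w hw
    have h5 := hW w hw
    rw [← h5.1, ← h5.2]
    congr 1
    simp [hP, hdeck]
  intro z
  ext
  exact congrFun h4 z

lemma discrete_of_near {Λ : Subgroup SL2R} (h : ∀ᶠ k : SL2R in 𝓝 1, k ∈ Λ → k = 1) :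
    DiscreteTopology Λ := by
  refine discreteTopology_of_isOpen_singleton_one ?_
  rw [isOpen_singleton_iff_nhds_eq_pure]
  refine le_antisymm ?_ (pure_le_nhds _)
  rw [le_pure_iff]
  have h1 : Tendsto (fun l : Λ => (l : SL2R)) (𝓝 1) (𝓝 ((1 : Λ) : SL2R)) :=
    continuous_subtype_val.tendsto 1
  have h2 := h1.eventually h
  filter_upwards [h2] with l hl
  exact Subtype.ext (hl l.2)

lemma comm_form {A X : SL2R} (h : A * X = X * A) (hX1 : X ≠ 1) (hX2 : X ≠ -1) :
    ∃ α β : ℝ, (A : Matrix (Fin 2) (Fin 2) ℝ) = α • (1 : Matrix (Fin 2) (Fin 2) ℝ) +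
      β • (X : Matrix (Fin 2) (Fin 2) ℝ) := by
  have h1 := congrArg (fun M : SL2R => (M : Matrix (Fin 2) (Fin 2) ℝ)) h
  simp only [Matrix.SpecialLinearGroup.coe_mul] at h1
  have e00 := congrFun (congrFun h1 0) 0
  have e01 := congrFun (congrFun h1 0) 1
  have e10 := congrFun (congrFun h1 1) 0
  simp only [Matrix.mul_apply, Fin.sum_univ_two] at e00 e01 e10
  suffices hs : ∃ β : ℝ, A 0 1 = β * X 0 1 ∧ A 1 0 = β * X 1 0 ∧
      A 0 0 - A 1 1 = β * (X 0 0 - X 1 1) by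
    obtain ⟨β, h01, h10, hd⟩ := hs
    refine ⟨A 0 0 - β * X 0 0, β, ?_⟩
    ext i j
    fin_cases i <;> fin_cases j <;> simp
    · exact h01
    · exact h10
    · linarith
  by_cases hb : X 0 1 = 0
  · by_cases hc : X 1 0 = 0
    · have hd : X 0 0 - X 1 1 ≠ 0 := by
        intro hcon
        rcases scalar_of hb hc (sub_eq_zero.1 hcon) with h | h
        · exact hX1 h
        · exact hX2 h
      refine ⟨(A 0 0 - A 1 1) / (X 0 0 - X 1 1), ?_, ?_, ?_⟩
      · rw [hb] at e01 ⊢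
        have : A 0 1 * (X 0 0 - X 1 1) = 0 := by linarith
        rcases mul_eq_zero.1 this with h | h
        · simp [h]
        · exact absurd h hd
      · rw [hc] at e10 ⊢
        have : A 1 0 * (X 0 0 - X 1 1) = 0 := by linarith
        rcases mul_eq_zero.1 this with h | h
        · simp [h]
        · exact absurd h hd
      · field_simp
    · refine ⟨A 1 0 / X 1 0, ?_, ?_, ?_⟩ <;> field_simp <;> linarith
  · refine ⟨A 0 1 / X 0 1, ?_, ?_, ?_⟩ <;> field_simp <;> linarith

lemma scalar_of_comm {l k1 k2 : SL2R} (h1 : l * k1 = k1 * l) (h2 : l * k2 = k2 * l)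
    (h12 : k1 * k2 ≠ k2 * k1) : l = 1 ∨ l = -1 := by
  by_contra hcon
  push Not at hcon
  obtain ⟨a, b, hab⟩ := comm_form h1.symm hcon.1 hcon.2
  obtain ⟨c, d, hcd⟩ := comm_form h2.symm hcon.1 hcon.2
  apply h12
  apply Subtype.ext
  show (k1 : Matrix (Fin 2) (Fin 2) ℝ) * k2 = k2 * k1
  rw [hab, hcd]
  simp only [add_mul, mul_add, smul_mul_smul_comm, mul_one, one_mul]
  simp only [mul_comm a, mul_comm b]
  abel

/-- The trace-free part of a matrix. -/
noncomputable def tf (X : SL2R) : Matrix (Fin 2) (Fin 2) ℝ :=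
  (X : Matrix (Fin 2) (Fin 2) ℝ) - ((X 0 0 + X 1 1) / 2) • (1 : Matrix (Fin 2) (Fin 2) ℝ)

lemma tf_ne {X : SL2R} (hX1 : X ≠ 1) (hX2 : X ≠ -1) : tf X ≠ 0 := by
  intro h
  have h01 := congrFun (congrFun h 0) 1
  have h10 := congrFun (congrFun h 1) 0
  have h00 := congrFun (congrFun h 0) 0
  simp [tf] at h01 h10 h00
  rcases scalar_of h01 h10 (by linarith) with h | h
  · exact hX1 h
  · exact hX2 h

lemma conj_cancel (g : SL2R) : (g : Matrix (Fin 2) (Fin 2) ℝ) *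
    ((g⁻¹ : SL2R) : Matrix (Fin 2) (Fin 2) ℝ) = 1 := by
  rw [← Matrix.SpecialLinearGroup.coe_mul, mul_inv_cancel, Matrix.SpecialLinearGroup.coe_one]

lemma trace_conj_sl (g X : SL2R) : (g * X * g⁻¹) 0 0 + (g * X * g⁻¹) 1 1 = X 0 0 + X 1 1 := by
  have h1 : Matrix.trace ((g * X * g⁻¹ : SL2R) : Matrix (Fin 2) (Fin 2) ℝ) =
      Matrix.trace (X : Matrix (Fin 2) (Fin 2) ℝ) := by
    rw [Matrix.SpecialLinearGroup.coe_mul, Matrix.trace_mul_comm,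
      ← Matrix.SpecialLinearGroup.coe_mul]
    simp
  simpa [Matrix.trace_fin_two] using h1

lemma tf_conj (g X : SL2R) : tf (g * X * g⁻¹) =
    (g : Matrix (Fin 2) (Fin 2) ℝ) * tf X * ((g⁻¹ : SL2R) : Matrix (Fin 2) (Fin 2) ℝ) := by
  unfold tf
  rw [trace_conj_sl]
  rw [mul_sub, sub_mul, Matrix.mul_smul, Matrix.smul_mul, mul_one, conj_cancel,
    Matrix.SpecialLinearGroup.coe_mul, Matrix.SpecialLinearGroup.coe_mul]

lemma tf_comm {g X : SL2R} (hX1 : X ≠ 1) (hX2 : X ≠ -1)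
    (h : (g * X * g⁻¹) * X = X * (g * X * g⁻¹)) : ∃ β : ℝ, tf (g * X * g⁻¹) = β • tf X := by
  obtain ⟨α, β, hab⟩ := comm_form h hX1 hX2
  refine ⟨β, ?_⟩
  have ht := trace_conj_sl g X
  generalize g * X * g⁻¹ = A at *
  have h00 := congrFun (congrFun hab 0) 0
  have h01 := congrFun (congrFun hab 0) 1
  have h10 := congrFun (congrFun hab 1) 0
  have h11 := congrFun (congrFun hab 1) 1
  simp at h00 h01 h10 h11
  unfold tf
  ext i j
  fin_cases i <;> fin_cases j <;> simp
  · linarith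
  · exact h01
  · exact h10
  · linarith

lemma coe_eq_tf (X : SL2R) : (X : Matrix (Fin 2) (Fin 2) ℝ) =
    ((X 0 0 + X 1 1) / 2) • (1 : Matrix (Fin 2) (Fin 2) ℝ) + tf X := by
  unfold tf; abel

lemma tf_det {X A : SL2R} {β : ℝ} (ht : A 0 0 + A 1 1 = X 0 0 + X 1 1)
    (h : tf A = β • tf X) : (1 - β ^ 2) * (1 - ((X 0 0 + X 1 1) / 2) ^ 2) = 0 := by
  have dA := sl_det A
  have dX := sl_det X
  have h00 := congrFun (congrFun h 0) 0
  have h01 := congrFun (congrFun h 0) 1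
  have h10 := congrFun (congrFun h 1) 0
  have h11 := congrFun (congrFun h 1) 1
  simp [tf] at h00 h01 h10 h11
  rw [ht] at h00 h11
  have a00 : A 0 0 = (X 0 0 + X 1 1) / 2 + β * (X 0 0 - (X 0 0 + X 1 1) / 2) := by linarith
  have a11 : A 1 1 = (X 0 0 + X 1 1) / 2 + β * (X 1 1 - (X 0 0 + X 1 1) / 2) := by linarith
  rw [a00, h01, h10, a11] at dA
  linear_combination β ^ 2 * dX - dA

lemma no_contract {Γ : Subgroup SL2R} [DiscreteTopology Γ] {X g : SL2R} (hX : X ∈ Γ)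
    (hX1 : X ≠ 1) (hX2 : X ≠ -1) (hg : g ∈ Γ) {β : ℝ} (h : tf (g * X * g⁻¹) = β • tf X) :
    1 ≤ |β| := by
  by_contra hlt
  push Not at hlt
  have hdet := tf_det (trace_conj_sl g X) h
  have hb : 1 - β ^ 2 ≠ 0 := by
    have : β ^ 2 < 1 := (sq_lt_one_iff_abs_lt_one β).2 hlt
    linarith
  have heps := (mul_eq_zero.1 hdet).resolve_left hb
  set ε := (X 0 0 + X 1 1) / 2 with hε
  have hE : ∃ E : SL2R, (E = 1 ∨ E = -1) ∧
      (E : Matrix (Fin 2) (Fin 2) ℝ) = ε • (1 : Matrix (Fin 2) (Fin 2) ℝ) := by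
    have : ε = 1 ∨ ε = -1 := by
      have : (ε - 1) * (ε + 1) = 0 := by linarith
      rcases mul_eq_zero.1 this with h | h
      · left; linarith
      · right; linarith
    rcases this with h | h
    · exact ⟨1, Or.inl rfl, by simp [h]⟩
    · exact ⟨-1, Or.inr rfl, by simp [h]⟩
  obtain ⟨E, hE1, hE2⟩ := hE
  have hseq : ∀ n : ℕ, tf (g ^ n * X * (g ^ n)⁻¹) = β ^ n • tf X := by
    intro n
    induction n with
    | zero => simp
    | succ n ih =>
      have : g ^ (n + 1) * X * (g ^ (n + 1))⁻¹ = g * (g ^ n * X * (g ^ n)⁻¹) * g⁻¹ := by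
        rw [pow_succ']; group
      rw [this, tf_conj, ih, Matrix.mul_smul, Matrix.smul_mul, ← tf_conj, h, smul_smul, pow_succ]
  set x : ℕ → SL2R := fun n => g ^ n * X * (g ^ n)⁻¹ with hx
  have hcoe : ∀ n, (x n : Matrix (Fin 2) (Fin 2) ℝ) =
      ε • (1 : Matrix (Fin 2) (Fin 2) ℝ) + β ^ n • tf X := by
    intro n
    rw [coe_eq_tf, trace_conj_sl, hseq]
  have hlim : Tendsto x atTop (𝓝 E) := by
    refine tendsto_subtype_rng.2 ?_
    have h1 : Tendsto (fun n : ℕ => ε • (1 : Matrix (Fin 2) (Fin 2) ℝ) + β ^ n • tf X) atTop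
        (𝓝 (ε • (1 : Matrix (Fin 2) (Fin 2) ℝ) + (0 : ℝ) • tf X)) :=
      tendsto_const_nhds.add ((tendsto_pow_atTop_nhds_zero_of_abs_lt_one hlt).smul_const _)
    rw [zero_smul, add_zero, ← hE2] at h1
    exact h1.congr fun n => by rw [hcoe n, hE2]
  have hxΓ : ∀ n, x n ∈ Γ := fun n =>
    Γ.mul_mem (Γ.mul_mem (Γ.pow_mem hg n) hX) (Γ.inv_mem (Γ.pow_mem hg n))
  have hclosed : IsClosed (Γ : Set SL2R) := Subgroup.isClosed_of_discrete
  have hEΓ : E ∈ Γ := hclosed.mem_of_tendsto hlim (Filter.Eventually.of_forall hxΓ)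
  have hlim' : Tendsto (fun n => (⟨x n, hxΓ n⟩ : Γ)) atTop (𝓝 (⟨E, hEΓ⟩ : Γ)) :=
    tendsto_subtype_rng.2 hlim
  rw [nhds_discrete, tendsto_pure] at hlim'
  obtain ⟨n, hn⟩ := hlim'.exists
  have hn' : g ^ n * X * (g ^ n)⁻¹ = E := congrArg Subtype.val hn
  have hXE : X = (g ^ n)⁻¹ * E * g ^ n := by rw [← hn']; group
  rcases hE1 with h | h
  · apply hX1; rw [hXE, h]; group
  · apply hX2; rw [hXE, h]; simp

lemma exists_noncomm {Γ : Subgroup SL2R} (hΓ : IsLattice Γ) {X : SL2R} (hX : X ∈ Γ)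
    (hX1 : X ≠ 1) (hX2 : X ≠ -1) :
    ∃ g ∈ Γ, (g * X * g⁻¹) * X ≠ X * (g * X * g⁻¹) := by
  by_contra hcon
  push Not at hcon
  have hdisc : DiscreteTopology Γ := hΓ.1
  have hform : ∀ g ∈ Γ, g * X * g⁻¹ ∈ ({X, X⁻¹} : Set SL2R) := by
    intro g hg
    obtain ⟨β, hβ⟩ := tf_comm hX1 hX2 (hcon g hg)
    have hg' := Γ.inv_mem hg
    obtain ⟨β', hβ'⟩ := tf_comm hX1 hX2 (hcon g⁻¹ hg')
    have h1 := no_contract hX hX1 hX2 hg hβ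
    have h2 := no_contract hX hX1 hX2 hg' hβ'
    have h3 : tf X = (β' * β) • tf X := by
      have e : X = g * (g⁻¹ * X * g⁻¹⁻¹) * g⁻¹ := by group
      conv_lhs => rw [e]
      rw [tf_conj, hβ', Matrix.mul_smul, Matrix.smul_mul, ← tf_conj, hβ, smul_smul]
    have h4 : β' * β = 1 := by
      have : (1 - β' * β) • tf X = 0 := by rw [sub_smul, one_smul, ← h3, sub_self]
      rcases smul_eq_zero.1 this with h | h
      · linarith
      · exact absurd h (tf_ne hX1 hX2)
    have h5 : |β'| * |β| = 1 := by rw [← abs_mul, h4, abs_one]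
    have h6 : |β| = 1 := by nlinarith
    have ht := trace_conj_sl g X
    generalize g * X * g⁻¹ = A at *
    have h00 := congrFun (congrFun hβ 0) 0
    have h01 := congrFun (congrFun hβ 0) 1
    have h10 := congrFun (congrFun hβ 1) 0
    have h11 := congrFun (congrFun hβ 1) 1
    simp [tf] at h00 h01 h10 h11
    rcases eq_or_eq_neg_of_abs_eq h6 with h | h
    · left
      rw [h] at h00 h01 h10 h11
      apply sl_ext <;> linarith
    · right
      rw [h] at h00 h01 h10 h11
      show A = X⁻¹
      rw [Matrix.SpecialLinearGroup.SL2_inv_expl]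
      apply sl_ext <;> simp <;> linarith
  set C : Subgroup Γ := Subgroup.centralizer {(⟨X, hX⟩ : Γ)} with hC
  have hmem : ∀ g : Γ, g ∈ C ↔ (g : SL2R) * X = X * g := by
    intro g
    rw [hC, Subgroup.mem_centralizer_singleton_iff, Subtype.ext_iff]
    simp only [Subgroup.coe_mul]
  have hfin : Finite (Γ ⧸ C) := by
    have hfs : Finite ({X, X⁻¹} : Set SL2R) := ((Set.finite_singleton _).insert _).to_subtype
    refine Finite.of_injective (fun c : Γ ⧸ C =>
      (⟨((Quotient.out c : Γ) : SL2R) * X * ((Quotient.out c : Γ) : SL2R)⁻¹,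
        hform _ (Quotient.out c : Γ).2⟩ : ({X, X⁻¹} : Set SL2R))) ?_
    intro c c' h
    have h1 := congrArg Subtype.val h
    simp only at h1
    rw [← QuotientGroup.out_eq' c, ← QuotientGroup.out_eq' c', QuotientGroup.eq, hmem]
    generalize ((Quotient.out c : Γ)) = a at *
    generalize ((Quotient.out c' : Γ)) = b at *
    simp only [Subgroup.coe_mul, Subgroup.coe_inv]
    rw [mul_inv_eq_iff_eq_mul] at h1
    calc (a : SL2R)⁻¹ * b * X = (a : SL2R)⁻¹ * (b * X * (b : SL2R)⁻¹ * a) * (a : SL2R)⁻¹ * b := by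
          group
      _ = (a : SL2R)⁻¹ * (a * X) * (a : SL2R)⁻¹ * b := by rw [h1]
      _ = X * ((a : SL2R)⁻¹ * b) := by group
  have hfi : C.FiniteIndex := Subgroup.finiteIndex_of_finite_quotient
  have huniq := uniq_thm Γ hΓ C (p := fun z => z) (q := fun z => X • z) holFun_id
    (holFun_smul holFun_id X) ⟨UpperHalfPlane.I, (2 : ℝ) +ᵥ UpperHalfPlane.I, by
      intro h
      have := congrArg UpperHalfPlane.re h
      simp at this⟩ (by
      intro γ hγ
      refine ⟨(γ : SL2R), fun z => ⟨rfl, ?_⟩⟩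
      simp only [smul_smul, (hmem γ).1 hγ])
  rcases triv_of_smul (k := X) (fun z => (congrFun huniq z).symm) with h | h
  · exact hX1 h
  · exact hX2 h

/-- Elements of `SL(2, ℝ)` which descend along `p`. -/
def descGroup (p : ℍ → ℍ) : Subgroup SL2R where
  carrier := {h | ∃ g : SL2R, ∀ z, p (h • z) = g • p z}
  mul_mem' := by
    rintro a b ⟨g, hg⟩ ⟨k, hk⟩
    exact ⟨g * k, fun z => by rw [mul_smul, hg, hk, mul_smul]⟩
  one_mem' := ⟨1, fun z => by simp⟩
  inv_mem' := by
    rintro a ⟨g, hg⟩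
    refine ⟨g⁻¹, fun z => ?_⟩
    rw [eq_inv_smul_iff, ← hg, smul_inv_smul]

lemma mem_descGroup {p : ℍ → ℍ} {h : SL2R} :
    h ∈ descGroup p ↔ ∃ g : SL2R, ∀ z, p (h • z) = g • p z := Iff.rfl

lemma deck_conj {p : ℍ → ℍ} {k l : SL2R} (hk : ∀ z, p (k • z) = p z) (hl : l ∈ descGroup p) :
    ∀ z, p ((l * k * l⁻¹) • z) = p z := by
  obtain ⟨g, hg⟩ := hl
  intro z
  rw [mul_smul, mul_smul, hg, hk, ← hg, smul_inv_smul]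

lemma deck_inv {p : ℍ → ℍ} {k : SL2R} (hk : ∀ z, p (k • z) = p z) :
    ∀ z, p (k⁻¹ • z) = p z := by
  intro z
  rw [← hk, smul_inv_smul]

lemma descGroup_discrete {p : ℍ → ℍ} (hp : HolFun (fun z => (p z : ℂ)))
    (hnc : ∃ z₁ z₂ : ℍ, p z₁ ≠ p z₂) {k1 k2 : SL2R} (h1 : ∀ z, p (k1 • z) = p z)
    (h2 : ∀ z, p (k2 • z) = p z) (h12 : k1 * k2 ≠ k2 * k1) :
    DiscreteTopology (descGroup p) := by
  refine discrete_of_near ?_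
  have hN := near_one_deck hp hnc
  have hc : ∀ k : SL2R, Tendsto (fun l : SL2R => l * k * l⁻¹ * k⁻¹) (𝓝 1) (𝓝 1) := by
    intro k
    have : Continuous (fun l : SL2R => l * k * l⁻¹ * k⁻¹) := by fun_prop
    have h := this.tendsto 1
    simpa using h
  have hcomm : ∀ k : SL2R, (∀ z, p (k • z) = p z) →
      ∀ᶠ l : SL2R in 𝓝 1, l ∈ descGroup p → l * k = k * l := by
    intro k hk
    filter_upwards [(hc k).eventually hN] with l hl hmem
    have h3 : l * k * l⁻¹ * k⁻¹ = 1 := hl (fun z => by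
      rw [mul_smul, deck_conj hk hmem, deck_inv hk])
    rw [mul_inv_eq_one, mul_inv_eq_iff_eq_mul] at h3
    exact h3
  filter_upwards [hcomm k1 h1, hcomm k2 h2, near_pos] with l hl1 hl2 hpos hmem
  exact eq_one_of_pos (scalar_of_comm (hl1 hmem) (hl2 hmem) h12) hpos

lemma commSet_le {Γ : Subgroup SL2R} (hΓ : IsLattice Γ) {ρ : Γ →* SL2R}
    {p : ℍ → ℍ} (hp : HolFun (fun z => (p z : ℂ))) (hnc : ∃ z₁ z₂ : ℍ, p z₁ ≠ p z₂)
    (heq : ∀ (γ : Γ) (z : ℍ), p ((γ : SL2R) • z) = ρ γ • p z) {h : SL2R}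
    (hh : h ∈ commSet Γ ρ) : h ∈ descGroup p := by
  obtain ⟨g, Γ', h₁, hle, hind, -, hrho⟩ := hh
  have hfi : (Γ'.subgroupOf Γ).FiniteIndex := ⟨hind⟩
  have huniq := uniq_thm Γ hΓ (Γ'.subgroupOf Γ) (p := p) (q := fun z => g • p (h⁻¹ • z)) hp
    (holFun_smul (p := fun z => p (h⁻¹ • z)) (hp.comp_smul h⁻¹) g) hnc (by
      intro γ hγ
      have hγ' : (γ : SL2R) ∈ Γ' := Subgroup.mem_subgroupOf.1 hγ
      refine ⟨ρ γ, fun z => ⟨heq γ z, ?_⟩⟩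
      have hm2 : h⁻¹ * (γ : SL2R) * h ∈ Γ := by
        obtain ⟨δ, hδ, hδ'⟩ := hle hγ'
        have : h * δ * h⁻¹ = γ := hδ'
        rw [← this]
        have e : h⁻¹ * (h * δ * h⁻¹) * h = δ := by group
        rw [e]
        exact hδ
      have h3 := hrho γ hγ' hm2 (g • p (h⁻¹ • z))
      show g • p (h⁻¹ • (γ : SL2R) • z) = ρ ⟨(γ : SL2R), h₁ hγ'⟩ • g • p (h⁻¹ • z)
      rw [h3, mul_smul, inv_smul_smul, mul_smul, ← heq]
      simp only [smul_smul]
      congr 3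
      group)
  refine mem_descGroup.2 ⟨g, fun z => ?_⟩
  have := congrFun huniq (h • z)
  rw [this]
  simp

/-- **Finiteness of the commensurator when the representation has a kernel**: if `(p, ρ)` is a
modular embedding of a lattice `Γ` with `p` nonconstant and `ρ` having a nontrivial kernel on
`ℍ`, then the commensurator set is contained in finitely many left cosets of `Γ`. -/
theorem commensurator_finitely_many_cosets
    (Γ : Subgroup SL2R) (hΓ : IsLattice Γ) (ρ : Γ →* SL2R)
    (p : ℍ → ℍ) (hp : IsHolomorphicMap p) (hnc : ∃ z₁ z₂ : ℍ, p z₁ ≠ p z₂)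
    (heq : ∀ (γ : Γ) (z : ℍ), p ((γ : SL2R) • z) = ρ γ • p z)
    (hker : ∃ γ : Γ,
      (((γ : SL2R) : Matrix (Fin 2) (Fin 2) ℝ) ≠ 1 ∧
       ((γ : SL2R) : Matrix (Fin 2) (Fin 2) ℝ) ≠ -1) ∧
      ((ρ γ : Matrix (Fin 2) (Fin 2) ℝ) = 1 ∨
       (ρ γ : Matrix (Fin 2) (Fin 2) ℝ) = -1)) :
    ∃ F : Finset SL2R, ∀ h ∈ commSet Γ ρ, ∃ f ∈ F, ∃ γ ∈ Γ, h = f * γ := by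
  have hp' := holFun_of_isHol hp
  obtain ⟨γ0, ⟨hn1, hn2⟩, hρ⟩ := hker
  have hX1 : (γ0 : SL2R) ≠ 1 := fun h => hn1 (by rw [h]; simp)
  have hX2 : (γ0 : SL2R) ≠ -1 := fun h => hn2 (by rw [h]; simp)
  have hk : ∀ z, p ((γ0 : SL2R) • z) = p z := by
    intro z
    rw [heq]
    rcases hρ with h | h
    · have h1 : ρ γ0 = 1 := Subtype.ext h
      rw [h1, one_smul]
    · have h1 : ρ γ0 = -1 := Subtype.ext (by rw [h]; simp)
      rw [h1]
      apply UpperHalfPlane.ext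
      rw [UpperHalfPlane.specialLinearGroup_apply]
      simp
  obtain ⟨g, hg, hne⟩ := exists_noncomm hΓ γ0.2 hX1 hX2
  have hle : Γ ≤ descGroup p :=
    fun γ hγ => mem_descGroup.2 ⟨ρ ⟨γ, hγ⟩, fun z => heq ⟨γ, hγ⟩ z⟩
  have hk2 := deck_conj hk (hle hg)
  have := descGroup_discrete hp' hnc hk2 hk hne
  obtain ⟨F, hF⟩ := finite_index_of_discrete Γ (descGroup p) hΓ hle
  exact ⟨F, fun h hh => hF h (commSet_le hΓ hp' hnc heq hh)⟩
end
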